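/- Let K be a compact subset of ℝ^{2n+1}. Then there exists a positive constant C_K > 0 such that for all u ∈ C_0^∞(ℝ^{2n+1}) with support contained in K, one has ‖(1 + |D_t|^{2σ/(2σ+1)} + |D_x|^{2σ/(2σ+1)} + |D_v|^{2σ}) u‖_{L²(ℝ^{2n+1})} ≤ C_K (‖Pu‖_{L²(ℝ^{2n+1})} + ‖u‖_{L²(ℝ^{2n+1})}). -/

import Mathlib

open MeasureTheory
open scoped ENNReal Real

noncomputable section

/-- `ℝ^n` with the Euclidean norm. -/
abbrev E (n : ℕ) : Type := EuclideanSpace ℝ (Fin n)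
/-- `ℝ^{2n+1} = ℝ_t × ℝ^n_x × ℝ^n_v` with the Euclidean norm. -/
abbrev Z (n : ℕ) : Type := EuclideanSpace ℝ (Unit ⊕ Fin n ⊕ Fin n)

variable {n : ℕ}

/-- the `t` (resp. dual `τ`) coordinate -/
def tC (ζ : Z n) : ℝ := ζ (Sum.inl ())
/-- the `x` (resp. dual `ξ`) coordinates -/
def xC (ζ : Z n) : E n := WithLp.toLp 2 (fun i => ζ (Sum.inr (Sum.inl i)))
/-- the `v` (resp. dual `η`) coordinates -/
def vC (ζ : Z n) : E n := WithLp.toLp 2 (fun i => ζ (Sum.inr (Sum.inr i)))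

/-- the unit vector in the `t` direction -/
def eT : Z n := EuclideanSpace.single (Sum.inl ()) 1
/-- the unit vector in the `xᵢ` direction -/
def eX (i : Fin n) : Z n := EuclideanSpace.single (Sum.inr (Sum.inl i)) 1

/-- the symbol `F(η) = |η|^{2σ} w(η) + |η|² (1 - w(η))` -/
def Fsym (σ : ℝ) (w : E n → ℝ) (η : E n) : ℝ :=
  ‖η‖ ^ (2 * σ) * w η + ‖η‖ ^ 2 * (1 - w η)

/-- the fractional Laplacian `(-Δ̃_v)^σ`, the Fourier multiplier with symbol `F(η)` -/
def fracLap (σ : ℝ) (w : E n → ℝ) (u : Z n → ℂ) : Z n → ℂ :=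
  FourierTransform.fourierInv (fun ζ : Z n => (Fsym σ w (vC ζ) : ℂ) * FourierTransform.fourier u ζ)

/-- the kinetic operator `P = ∂_t + v⋅∂_x + a(t,x,v) (-Δ̃_v)^σ` -/
def Pop (σ : ℝ) (w : E n → ℝ) (a : Z n → ℝ) (u : Z n → ℂ) (z : Z n) : ℂ :=
  fderiv ℝ u z eT + ∑ i : Fin n, (vC z i : ℂ) * fderiv ℝ u z (eX i)
    + (a z : ℂ) * fracLap σ w u z

section PartA

open FourierTransform SchwartzMap in
/-- Plancherel for functions in `L¹ ∩ L²`. -/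
lemma planch {f : Z n → ℂ} (hf : Integrable f) (hf2 : MemLp f 2 volume) :
    eLpNorm (𝓕 f) 2 volume = eLpNorm f 2 volume := by
  set T := hf2.toLp f with hT
  have hcont : Continuous (𝓕 f) :=
    VectorFourier.fourierIntegral_continuous Real.continuous_fourierChar
      (by exact continuous_inner) hf
  have key : ∀ᵐ x ∂(volume : Measure (Z n)), 𝓕 f x = (𝓕 T : Lp (α := Z n) ℂ 2 volume) x := by
    apply ae_eq_of_integral_contDiff_smul_eq hcont.locallyIntegrable
    · exact (Lp.memLp _).locallyIntegrable (by norm_num)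
    intro g hg hgs
    have hgc : ContDiff ℝ (⊤ : ℕ∞) (fun x => (g x : ℂ)) := Complex.ofRealCLM.contDiff.comp hg
    have hgcs : HasCompactSupport (fun x => (g x : ℂ)) := hgs.comp_left (g := fun y : ℝ => (y : ℂ)) (by simp)
    set φ : 𝓢(Z n, ℂ) := hgcs.toSchwartzMap hgc with hφ
    have hφx : ∀ x, φ x = (g x : ℂ) := fun x => rfl
    have h1 := congrArg (fun D => D φ) (Lp.fourier_toTemperedDistribution_eq T)
    simp only [TemperedDistribution.fourier_apply, Lp.toTemperedDistribution_apply] at h1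
    have h2 : ∫ x, (𝓕 f x) • (φ x) = ∫ x, f x • (𝓕 (φ : Z n → ℂ) x) :=
      VectorFourier.integral_fourierIntegral_smul_eq_flip (L := innerₗ (Z n))
        Real.continuous_fourierChar (by exact continuous_inner) hf φ.integrable
        |>.trans (by simp only [flip_innerₗ]; rfl)
    calc ∫ x, g x • 𝓕 f x = ∫ x, (𝓕 f x) • (φ x) := by
          congr 1; ext x; rw [hφx, smul_eq_mul, Complex.real_smul, mul_comm]
      _ = ∫ x, f x • (𝓕 (φ : Z n → ℂ) x) := h2
      _ = ∫ x, (𝓕 φ) x • T x := by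
          apply integral_congr_ae
          filter_upwards [hf2.coeFn_toLp] with x hx
          rw [hT, hx, fourier_coe, smul_eq_mul, smul_eq_mul, mul_comm]
      _ = _ := by
          rw [h1]
          congr 1
  rw [eLpNorm_congr_ae key]
  have h3 := Lp.norm_fourier_eq T
  rw [Lp.norm_def, Lp.norm_def, ENNReal.toReal_eq_toReal_iff' (Lp.eLpNorm_ne_top _) (Lp.eLpNorm_ne_top _)] at h3
  rw [h3, eLpNorm_congr_ae hf2.coeFn_toLp]

open FourierTransform in
lemma fourier_cont {f : Z n → ℂ} (hf : Integrable f) : Continuous (𝓕 f) :=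
  VectorFourier.fourierIntegral_continuous Real.continuous_fourierChar
      (by exact continuous_inner) hf

open FourierTransform in
lemma fourierInv_cont {f : Z n → ℂ} (hf : Integrable f) : Continuous (𝓕⁻ f) := by
  have : 𝓕⁻ f = fun x => 𝓕 f (-x) := by
    ext x; exact Real.fourierInv_eq_fourier_neg f x
  rw [this]
  exact (fourier_cont hf).comp continuous_neg

open FourierTransform in
lemma planchInv {f : Z n → ℂ} (hf : Integrable f) (hf2 : MemLp f 2 volume) :
    eLpNorm (𝓕⁻ f) 2 volume = eLpNorm f 2 volume := by
  have : 𝓕⁻ f = (𝓕 f) ∘ (fun x => -x) := by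
    ext x; exact Real.fourierInv_eq_fourier_neg f x
  rw [this, eLpNorm_comp_measurePreserving (fourier_cont hf).aestronglyMeasurable
    (Measure.measurePreserving_neg volume), planch hf hf2]

open FourierTransform in
lemma planchInv_memLp {f : Z n → ℂ} (hf : Integrable f) (hf2 : MemLp f 2 volume) :
    MemLp (𝓕⁻ f) 2 volume :=
  ⟨(fourierInv_cont hf).aestronglyMeasurable, by rw [planchInv hf hf2]; exact hf2.2⟩

/-- Young inequality `L¹ * L² → L²`, in lintegral form. -/
lemma young_lintegral {K g : Z n → ℝ≥0∞} (hK : Measurable K) (hg : Measurable g) :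
    ∫⁻ ζ, (∫⁻ κ, K κ * g (ζ - κ)) ^ (2 : ℝ) ≤ (∫⁻ κ, K κ) ^ (2 : ℝ) * ∫⁻ ζ, g ζ ^ (2 : ℝ) := by
  have h1 : ∀ ζ, (∫⁻ κ, K κ * g (ζ - κ)) ^ (2 : ℝ)
      ≤ (∫⁻ κ, K κ) * ∫⁻ κ, K κ * g (ζ - κ) ^ (2 : ℝ) := by
    intro ζ
    have hgm : Measurable fun κ => g (ζ - κ) := hg.comp (measurable_const.sub measurable_id)
    have := ENNReal.lintegral_mul_le_Lp_mul_Lq volume (p := 2) (q := 2)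
      Real.HolderConjugate.two_two
      (f := fun κ => K κ ^ (1/2 : ℝ)) (g := fun κ => K κ ^ (1/2 : ℝ) * g (ζ - κ))
      (hK.pow_const _).aemeasurable ((hK.pow_const _).mul hgm).aemeasurable
    have e1 : ∀ κ, ((fun κ => K κ ^ (1/2 : ℝ)) * (fun κ => K κ ^ (1/2 : ℝ) * g (ζ - κ))) κ
        = K κ * g (ζ - κ) := by
      intro κ
      simp only [Pi.mul_apply]
      rw [← mul_assoc, ← ENNReal.rpow_add_of_nonneg _ _ (by norm_num) (by norm_num)]
      norm_num
    have e2 : ∀ κ, (K κ ^ (1/2 : ℝ)) ^ (2:ℝ) = K κ := by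
      intro κ; rw [← ENNReal.rpow_mul]; norm_num
    have e3 : ∀ κ, (K κ ^ (1/2 : ℝ) * g (ζ - κ)) ^ (2:ℝ) = K κ * g (ζ - κ) ^ (2:ℝ) := by
      intro κ; rw [ENNReal.mul_rpow_of_nonneg _ _ (by norm_num), e2]
    simp only [e1, e2, e3] at this
    calc _ ≤ ((∫⁻ κ, K κ) ^ (1/2 : ℝ) * (∫⁻ κ, K κ * g (ζ - κ) ^ (2 : ℝ)) ^ (1/2 : ℝ)) ^ (2:ℝ) := by
          gcongr
      _ = _ := by
          rw [ENNReal.mul_rpow_of_nonneg _ _ (by norm_num), ← ENNReal.rpow_mul, ← ENNReal.rpow_mul]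
          norm_num
  calc _ ≤ ∫⁻ ζ, (∫⁻ κ, K κ) * ∫⁻ κ, K κ * g (ζ - κ) ^ (2 : ℝ) := lintegral_mono h1
    _ = (∫⁻ κ, K κ) * ∫⁻ ζ, ∫⁻ κ, K κ * g (ζ - κ) ^ (2 : ℝ) := by
        rw [lintegral_const_mul]
        apply Measurable.lintegral_prod_right'
          (f := fun p : Z n × Z n => K p.2 * g (p.1 - p.2) ^ (2:ℝ))
        exact (hK.comp measurable_snd).mul
          ((hg.comp (measurable_fst.sub measurable_snd)).pow_const _)
    _ = (∫⁻ κ, K κ) * ∫⁻ κ, ∫⁻ ζ, K κ * g (ζ - κ) ^ (2 : ℝ) := by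
        rw [lintegral_lintegral_swap]
        exact ((hK.comp measurable_snd).mul
          ((hg.comp (measurable_fst.sub measurable_snd)).pow_const _)).aemeasurable
    _ = (∫⁻ κ, K κ) * ∫⁻ κ, K κ * ∫⁻ ζ, g ζ ^ (2 : ℝ) := by
        congr 2; ext κ
        have hm : Measurable fun ζ => g (ζ - κ) ^ (2 : ℝ) :=
          (hg.comp (measurable_id.sub measurable_const)).pow_const _
        rw [lintegral_const_mul _ hm]
        congr 1
        exact lintegral_sub_right_eq_self (fun ζ => g ζ ^ (2:ℝ)) κ
    _ = _ := by
        rw [lintegral_mul_const _ hK, ← mul_assoc]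
        congr 1
        rw [ENNReal.rpow_two, sq]

lemma young_eLpNorm {f k g : Z n → ℂ} (hk : Measurable k) (hg : Measurable g)
    (h : ∀ ζ, ‖f ζ‖ₑ ≤ ∫⁻ κ, ‖k κ‖ₑ * ‖g (ζ - κ)‖ₑ) :
    eLpNorm f 2 volume ≤ (∫⁻ κ, ‖k κ‖ₑ) * eLpNorm g 2 volume := by
  rw [eLpNorm_eq_lintegral_rpow_enorm_toReal (by norm_num) (by norm_num),
    eLpNorm_eq_lintegral_rpow_enorm_toReal (by norm_num) (by norm_num)]
  simp only [ENNReal.toReal_ofNat]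
  calc _ ≤ (∫⁻ ζ, (∫⁻ κ, ‖k κ‖ₑ * ‖g (ζ - κ)‖ₑ) ^ (2:ℝ)) ^ (1/2:ℝ) := by
        gcongr with ζ; exact h ζ
    _ ≤ ((∫⁻ κ, ‖k κ‖ₑ) ^ (2 : ℝ) * ∫⁻ ζ, ‖g ζ‖ₑ ^ (2 : ℝ)) ^ (1/2:ℝ) := by
        gcongr; exact young_lintegral hk.enorm hg.enorm
    _ = _ := by
        rw [ENNReal.mul_rpow_of_nonneg _ _ (by norm_num), ← ENNReal.rpow_mul]
        norm_num

end PartA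

section PartB

/-- the `L²` norm as a real number -/
def nrm (f : Z n → ℂ) : ℝ := (eLpNorm f 2 volume).toReal

/-- being in `L²` -/
abbrev L2 (f : Z n → ℂ) : Prop := MemLp f 2 volume

lemma nrm_nonneg (f : Z n → ℂ) : 0 ≤ nrm f := ENNReal.toReal_nonneg

lemma nrm_add_le {f g : Z n → ℂ} (hf : L2 f) (hg : L2 g) :
    nrm (fun x => f x + g x) ≤ nrm f + nrm g := by
  unfold nrm
  rw [← ENNReal.toReal_add hf.2.ne hg.2.ne]
  exact ENNReal.toReal_mono (ENNReal.add_ne_top.2 ⟨hf.2.ne, hg.2.ne⟩)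
    (eLpNorm_add_le hf.1 hg.1 (by norm_num))

lemma nrm_sub_le {f g : Z n → ℂ} (hf : L2 f) (hg : L2 g) :
    nrm (fun x => f x - g x) ≤ nrm f + nrm g := by
  unfold nrm
  rw [← ENNReal.toReal_add hf.2.ne hg.2.ne]
  exact ENNReal.toReal_mono (ENNReal.add_ne_top.2 ⟨hf.2.ne, hg.2.ne⟩)
    (eLpNorm_sub_le hf.1 hg.1 (by norm_num))

lemma nrm_sum_le {ι : Type*} (s : Finset ι) {f : ι → Z n → ℂ} (hf : ∀ i, L2 (f i)) :
    nrm (fun x => ∑ i ∈ s, f i x) ≤ ∑ i ∈ s, nrm (f i) := by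
  classical
  induction s using Finset.induction_on with
  | empty => simp [nrm]
  | insert a s ha ih =>
    simp only [Finset.sum_insert ha]
    refine (nrm_add_le (hf a) (memLp_finsetSum s (fun i _ => hf i))).trans ?_
    gcongr

lemma nrm_mono {f g : Z n → ℂ} (hg : L2 g) {C : ℝ} (hC : 0 ≤ C)
    (h : ∀ x, ‖f x‖ ≤ C * ‖g x‖) : nrm f ≤ C * nrm g := by
  unfold nrm
  have h1 : eLpNorm f 2 volume ≤ ENNReal.ofReal C * eLpNorm g 2 volume :=
    eLpNorm_le_mul_eLpNorm_of_ae_le_mul (Filter.Eventually.of_forall h) 2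
  have h2 := ENNReal.toReal_mono (ENNReal.mul_ne_top ENNReal.ofReal_ne_top hg.2.ne) h1
  rwa [ENNReal.toReal_mul, ENNReal.toReal_ofReal hC] at h2

lemma nrm_mono1 {f g : Z n → ℂ} (hg : L2 g)
    (h : ∀ x, ‖f x‖ ≤ ‖g x‖) : nrm f ≤ nrm g := by
  simpa using nrm_mono hg zero_le_one (by simpa using h)

lemma nrm_sq {f : Z n → ℂ} (hf : L2 f) : nrm f ^ 2 = ∫ x, ‖f x‖ ^ 2 := by
  unfold nrm
  rw [hf.eLpNorm_eq_integral_rpow_norm (by norm_num) (by norm_num)]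
  simp only [ENNReal.toReal_ofNat, Real.rpow_two]
  have h0 : 0 ≤ ∫ x, ‖f x‖ ^ 2 := integral_nonneg (fun x => by positivity)
  rw [ENNReal.toReal_ofReal (by positivity), ← Real.rpow_natCast, ← Real.rpow_mul h0]
  norm_num

lemma L2.sq_int {f : Z n → ℂ} (hf : L2 f) : Integrable (fun x => ‖f x‖ ^ 2) :=
  hf.integrable_norm_pow (p := 2) (by norm_num)

lemma L2.mul_int {f g : Z n → ℂ} (hf : L2 f) (hg : L2 g) :
    Integrable (fun x => ‖f x‖ * ‖g x‖) :=
  hf.norm.integrable_mul hg.norm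

lemma cs {f g : Z n → ℂ} (hf : L2 f) (hg : L2 g) :
    ∫ x, ‖f x‖ * ‖g x‖ ≤ nrm f * nrm g := by
  have := integral_mul_le_Lp_mul_Lq_of_nonneg (μ := (volume : Measure (Z n))) (p := 2) (q := 2)
    Real.HolderConjugate.two_two (f := fun x => ‖f x‖) (g := fun x => ‖g x‖)
    (Filter.Eventually.of_forall fun x => norm_nonneg _)
    (Filter.Eventually.of_forall fun x => norm_nonneg _)
    (by simpa using hf.norm) (by simpa using hg.norm)
  refine this.trans (le_of_eq ?_)
  simp only [Real.rpow_two]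
  rw [← nrm_sq hf, ← nrm_sq hg, ← Real.rpow_natCast, ← Real.rpow_natCast,
    ← Real.rpow_mul (nrm_nonneg _), ← Real.rpow_mul (nrm_nonneg _)]
  norm_num

/-- continuous functions of polynomial growth -/
def PG (m : Z n → ℝ) : Prop := Continuous m ∧ ∃ (C : ℝ) (k : ℕ), 0 ≤ C ∧ ∀ ζ, |m ζ| ≤ C * (1 + ‖ζ‖) ^ k

lemma PG.of_le {m p : Z n → ℝ} (hm : Continuous m) (hp : PG p) (h : ∀ ζ, |m ζ| ≤ p ζ) : PG m := by
  obtain ⟨_, C, k, hC, hb⟩ := hp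
  exact ⟨hm, C, k, hC, fun ζ => (h ζ).trans ((le_abs_self _).trans (hb ζ))⟩

lemma PG.const (c : ℝ) : PG (fun _ : Z n => c) :=
  ⟨continuous_const, |c|, 0, abs_nonneg _, fun ζ => by simp⟩

lemma PG.mul {m p : Z n → ℝ} (hm : PG m) (hp : PG p) : PG (fun ζ => m ζ * p ζ) := by
  obtain ⟨h1, C, k, hC, hb⟩ := hm
  obtain ⟨h2, D, l, hD, hd⟩ := hp
  refine ⟨h1.mul h2, C * D, k + l, by positivity, fun ζ => ?_⟩
  rw [abs_mul, pow_add]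
  calc _ ≤ (C * (1 + ‖ζ‖) ^ k) * (D * (1 + ‖ζ‖) ^ l) := by
        gcongr; exacts [hb ζ, hd ζ]
    _ = _ := by ring

lemma PG.add {m p : Z n → ℝ} (hm : PG m) (hp : PG p) : PG (fun ζ => m ζ + p ζ) := by
  obtain ⟨h1, C, k, hC, hb⟩ := hm
  obtain ⟨h2, D, l, hD, hd⟩ := hp
  refine ⟨h1.add h2, C + D, k + l, by positivity, fun ζ => ?_⟩
  have h0 : 1 ≤ 1 + ‖ζ‖ := by linarith [norm_nonneg ζ]
  calc _ ≤ |m ζ| + |p ζ| := abs_add_le _ _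
    _ ≤ C * (1 + ‖ζ‖) ^ k + D * (1 + ‖ζ‖) ^ l := add_le_add (hb ζ) (hd ζ)
    _ ≤ C * (1 + ‖ζ‖) ^ (k + l) + D * (1 + ‖ζ‖) ^ (k + l) := by
        gcongr <;> first | exact h0 | omega
    _ = _ := by ring

lemma PG.sum {ι : Type*} (s : Finset ι) {m : ι → Z n → ℝ} (hm : ∀ i, PG (m i)) :
    PG (fun ζ => ∑ i ∈ s, m i ζ) := by
  classical
  induction s using Finset.induction_on with
  | empty => simpa using PG.const 0
  | insert a s ha ih => simpa only [Finset.sum_insert ha] using (hm a).add ih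

lemma PG.pow {m : Z n → ℝ} (hm : PG m) (N : ℕ) : PG (fun ζ => m ζ ^ N) := by
  induction N with
  | zero => simpa using PG.const 1
  | succ N ih => simpa only [pow_succ] using ih.mul hm

lemma PG.rpow {m : Z n → ℝ} (hm : PG m) (h1 : ∀ ζ, 1 ≤ m ζ) (r : ℝ) :
    PG (fun ζ => m ζ ^ r) := by
  obtain ⟨N, hN⟩ := exists_nat_ge r
  refine PG.of_le (hm.1.rpow_const fun ζ => Or.inl (by linarith [h1 ζ])) (hm.pow N) fun ζ => ?_
  have : 0 ≤ m ζ ^ r := Real.rpow_nonneg (by linarith [h1 ζ]) _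
  rw [abs_of_nonneg this, ← Real.rpow_natCast]
  exact Real.rpow_le_rpow_of_exponent_le (h1 ζ) hN

lemma PG.rpow0 {m : Z n → ℝ} (hm : PG m) (h1 : ∀ ζ, 0 ≤ m ζ) {r : ℝ} (hr : 0 ≤ r) :
    PG (fun ζ => m ζ ^ r) := by
  have hp := ((PG.const (n := n) 1).add hm).rpow (fun ζ => by linarith [h1 ζ]) r
  refine PG.of_le (hm.1.rpow_const fun ζ => Or.inr hr) hp fun ζ => ?_
  rw [abs_of_nonneg (Real.rpow_nonneg (h1 ζ) _)]
  exact Real.rpow_le_rpow (h1 ζ) (by linarith) hr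

lemma PG.norm : PG (fun ζ : Z n => ‖ζ‖) :=
  ⟨continuous_norm, 1, 1, zero_le_one, fun ζ => by simp⟩

lemma PG.memL1 {m : Z n → ℝ} (hm : PG m) (g : SchwartzMap (Z n) ℂ) :
    Integrable (fun ζ => (m ζ : ℂ) * g ζ) := by
  obtain ⟨hc, C, k, hC, hb⟩ := hm
  have hI : Integrable (fun ζ : Z n => C * (2 ^ k * (‖g ζ‖ + ‖ζ‖ ^ k * ‖g ζ‖))) :=
    ((g.integrable.norm.add (g.integrable_pow_mul volume k)).const_mul _).const_mul _
  refine hI.mono ((Complex.continuous_ofReal.comp hc).mul g.continuous).aestronglyMeasurable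
    (Filter.Eventually.of_forall fun ζ => ?_)
  rw [norm_mul, Complex.norm_real, Real.norm_eq_abs]
  have h2 : (1 + ‖ζ‖) ^ k ≤ 2 ^ k * (1 + ‖ζ‖ ^ k) := by
    have := add_pow_le (a := (1:ℝ)) (b := ‖ζ‖) zero_le_one (norm_nonneg _) k
    refine this.trans ?_
    rw [one_pow]
    have h3 : (2:ℝ) ^ (k - 1) ≤ 2 ^ k := pow_le_pow_right₀ (by norm_num) (by omega)
    gcongr
  calc |m ζ| * ‖g ζ‖ ≤ (C * (2 ^ k * (1 + ‖ζ‖ ^ k))) * ‖g ζ‖ := by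
        gcongr; exact (hb ζ).trans (by gcongr)
    _ = C * (2 ^ k * (‖g ζ‖ + ‖ζ‖ ^ k * ‖g ζ‖)) := by ring
    _ ≤ _ := Real.le_norm_self _

lemma PG.memL2 {m : Z n → ℝ} (hm : PG m) (g : SchwartzMap (Z n) ℂ) :
    L2 (fun ζ => (m ζ : ℂ) * g ζ) := by
  have hcont : Continuous fun ζ => (m ζ : ℂ) * g ζ :=
    (Complex.continuous_ofReal.comp hm.1).mul g.continuous
  rw [L2, memLp_two_iff_integrable_sq_norm hcont.aestronglyMeasurable]
  obtain ⟨C, hC⟩ : ∃ C, ∀ ζ, ‖g ζ‖ ≤ C := by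
    obtain ⟨C, _, hC⟩ := g.decay 0 0
    exact ⟨C, fun ζ => by simpa using hC ζ⟩
  have h0 : 0 ≤ C := (norm_nonneg _).trans (hC 0)
  refine (((hm.pow 2).memL1 g).norm.const_mul C).mono
    (hcont.norm.pow 2).aestronglyMeasurable (Filter.Eventually.of_forall fun ζ => ?_)
  simp only [norm_mul, Complex.norm_real, norm_pow, norm_norm, Real.norm_eq_abs, sq_abs, mul_pow, abs_pow, abs_abs,
    abs_norm]
  rw [abs_of_nonneg h0]
  calc _ = ‖g ζ‖ * (m ζ ^ 2 * ‖g ζ‖) := by ring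
    _ ≤ _ := by gcongr; exact hC ζ

/-- real-valued integrability -/
lemma PG.int2 {m : Z n → ℝ} (hm : PG m) (f g : SchwartzMap (Z n) ℂ) :
    Integrable (fun ζ => m ζ * (f ζ * (starRingEnd ℂ) (g ζ)).re) := by
  have h1 := (hm.memL2 f).mul_int (((PG.const 1).memL2 g))
  refine h1.mono ?_ (Filter.Eventually.of_forall fun ζ => ?_)
  · refine (hm.1.mul (Complex.continuous_re.comp
      (f.continuous.mul (Complex.continuous_conj.comp g.continuous)))).aestronglyMeasurable
  · simp only [norm_mul, Complex.norm_real, Complex.ofReal_one, one_mul, norm_norm]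
    rw [mul_assoc]
    gcongr
    refine (Complex.abs_re_le_norm _).trans ?_
    simp

lemma PG.int_sq {m : Z n → ℝ} (hm : PG m) (g : SchwartzMap (Z n) ℂ) :
    Integrable (fun ζ => m ζ * ‖g ζ‖ ^ 2) := by
  refine (hm.int2 g g).congr (Filter.Eventually.of_forall fun ζ => ?_)
  simp only [Complex.mul_conj, Complex.ofReal_re, Complex.normSq_eq_norm_sq]

end PartB

section PartC

/-- the unit vector in the `vᵢ` direction -/
def eV (i : Fin n) : Z n := EuclideanSpace.single (Sum.inr (Sum.inr i)) 1

lemma xC_add_eV (ζ : Z n) (t : ℝ) (j : Fin n) : xC (ζ + t • eV j) = xC ζ := by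
  ext i; simp [xC, eV]

lemma vC_add_eV (ζ : Z n) (t : ℝ) (j : Fin n) :
    vC (ζ + t • eV j) = vC ζ + t • EuclideanSpace.single j 1 := by
  ext i
  by_cases h : i = j
  · subst h; simp [vC, eV]
  · simp [vC, eV, h]

lemma xC_cont : Continuous (xC : Z n → E n) := by unfold xC; fun_prop
lemma vC_cont : Continuous (vC : Z n → E n) := by unfold vC; fun_prop
lemma tC_cont : Continuous (tC : Z n → ℝ) := by unfold tC; fun_prop

lemma norm_sq_Z (ζ : Z n) : ‖ζ‖ ^ 2 = tC ζ ^ 2 + ‖xC ζ‖ ^ 2 + ‖vC ζ‖ ^ 2 := by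
  simp only [EuclideanSpace.norm_sq_eq, Fintype.sum_sum_type, tC, xC, vC]
  simp [add_assoc]

lemma xC_le (ζ : Z n) : ‖xC ζ‖ ≤ ‖ζ‖ := by
  have := norm_sq_Z ζ
  exact le_of_sq_le_sq (by nlinarith [sq_nonneg (tC ζ), sq_nonneg ‖vC ζ‖]) (norm_nonneg _)
lemma vC_le (ζ : Z n) : ‖vC ζ‖ ≤ ‖ζ‖ := by
  have := norm_sq_Z ζ
  exact le_of_sq_le_sq (by nlinarith [sq_nonneg (tC ζ), sq_nonneg ‖xC ζ‖]) (norm_nonneg _)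
lemma tC_le (ζ : Z n) : |tC ζ| ≤ ‖ζ‖ := by
  have := norm_sq_Z ζ
  exact abs_le_of_sq_le_sq (by nlinarith [sq_nonneg ‖vC ζ‖, sq_nonneg ‖xC ζ‖]) (norm_nonneg _)

lemma PG.xn : PG (fun ζ : Z n => ‖xC ζ‖) :=
  PG.of_le xC_cont.norm PG.norm fun ζ => by rw [abs_norm]; exact xC_le ζ
lemma PG.vn : PG (fun ζ : Z n => ‖vC ζ‖) :=
  PG.of_le vC_cont.norm PG.norm fun ζ => by rw [abs_norm]; exact vC_le ζ
lemma PG.t : PG (fun ζ : Z n => tC ζ) := PG.of_le tC_cont PG.norm tC_le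
lemma PG.x (i : Fin n) : PG (fun ζ : Z n => xC ζ i) :=
  PG.of_le (by unfold xC; fun_prop) PG.xn fun ζ => by
    simpa using PiLp.norm_apply_le (xC ζ) i
lemma PG.v (i : Fin n) : PG (fun ζ : Z n => vC ζ i) :=
  PG.of_le (by unfold vC; fun_prop) PG.vn fun ζ => by
    simpa using PiLp.norm_apply_le (vC ζ) i
lemma PG.inner : PG (fun ζ : Z n => inner ℝ (vC ζ) (xC ζ)) :=
  PG.of_le (vC_cont.inner xC_cont) (PG.vn.mul PG.xn) fun _ => abs_real_inner_le_norm _ _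

open LineDeriv in
/-- Fourier side of `∂_t + v·∂_x`. -/
def hS (g : SchwartzMap (Z n) ℂ) (ζ : Z n) : ℂ :=
  2 * π * Complex.I * (tC ζ : ℂ) * g ζ - ∑ j, (xC ζ j : ℂ) * (∂_{eV j} g) ζ

lemma hS_L2 (g : SchwartzMap (Z n) ℂ) : L2 (hS g) := by
  unfold hS
  refine MemLp.sub ?_ (memLp_finsetSum _ fun j _ => (PG.x j).memL2 _)
  have := (PG.t.memL2 g).const_mul (2 * π * Complex.I)
  refine this.congr_norm ?_ ?_ <;> simp [mul_assoc]
  · exact Continuous.aestronglyMeasurable (by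
      have := g.continuous; have := tC_cont (n := n); fun_prop)

lemma hS_L1 (g : SchwartzMap (Z n) ℂ) : Integrable (hS g) := by
  unfold hS
  refine Integrable.sub ?_ (integrable_finsetSum _ fun j _ => (PG.x j).memL1 _)
  have := (PG.t.memL1 g).const_mul (2 * π * Complex.I)
  simpa only [mul_assoc] using this

open LineDeriv in
lemma energy (g : SchwartzMap (Z n) ℂ) {M : Z n → ℝ} {M' : Fin n → Z n → ℝ} (hM : PG M)
    (hM' : ∀ j, PG (M' j)) (hd : ∀ j ζ, HasLineDerivAt ℝ M (M' j ζ) ζ (eV j)) :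
    ∫ ζ, M ζ * (hS g ζ * (starRingEnd ℂ) (g ζ)).re
      = 1 / 2 * ∫ ζ, (∑ j, xC ζ j * M' j ζ) * ‖g ζ‖ ^ 2 := by
  have hj : ∀ j, ∫ ζ, (xC ζ j * M ζ) * (2 * ((∂_{eV j} g) ζ * (starRingEnd ℂ) (g ζ)).re)
      = - ∫ ζ, (xC ζ j * M' j ζ) * ‖g ζ‖ ^ 2 := by
    intro j
    have hi1 := (((PG.x j).mul (hM' j))).int_sq g
    have hi2 := (((PG.x j).mul hM)).int_sq g
    have hi3 := (((PG.const 2).mul ((PG.x j).mul hM))).int2 (∂_{eV j} g) g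
    refine integral_bilinear_hasLineDerivAt_right_eq_neg_left_of_integrable
      (μ := volume) (B := ContinuousLinearMap.mul ℝ ℝ) (v := eV j) (f := fun ζ => xC ζ j * M ζ)
      (f' := fun ζ => xC ζ j * M' j ζ) (g := fun ζ => ‖g ζ‖ ^ 2)
      (g' := fun ζ => 2 * ((∂_{eV j} g) ζ * (starRingEnd ℂ) (g ζ)).re) ?_ ?_ ?_ ?_ ?_
    · exact hi1
    · refine hi3.congr (Filter.Eventually.of_forall fun ζ => ?_)
      simp only [ContinuousLinearMap.mul_apply']
      ring
    · exact hi2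
    · intro ζ _
      have := hd j ζ
      unfold HasLineDerivAt at this ⊢
      simp only [xC_add_eV]
      exact this.const_mul _
    · intro ζ _
      have h1 : HasLineDerivAt ℝ g (fderiv ℝ g ζ (eV j)) ζ (eV j) :=
        (g.differentiableAt.hasFDerivAt).hasLineDerivAt _
      unfold HasLineDerivAt at h1 ⊢
      have h2 := h1.norm_sq
      convert! h2 using 1
      rw [SchwartzMap.lineDerivOp_apply_eq_fderiv]
      simp only [zero_smul, add_zero]
      rw [← real_inner_comm]
      simp [Complex.inner]
      ring
  have e1 : ∀ ζ, M ζ * (hS g ζ * (starRingEnd ℂ) (g ζ)).re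
      = ∑ j, (-1/2) * ((xC ζ j * M ζ) * (2 * ((∂_{eV j} g) ζ * (starRingEnd ℂ) (g ζ)).re)) := by
    intro ζ
    have : (2 * π * Complex.I * (tC ζ : ℂ) * g ζ * (starRingEnd ℂ) (g ζ)).re = 0 := by
      rw [mul_assoc, Complex.mul_conj]
      simp
    rw [hS, sub_mul, Complex.sub_re, this, Finset.sum_mul, Complex.re_sum, zero_sub, mul_neg,
      Finset.mul_sum, ← Finset.sum_neg_distrib]
    refine Finset.sum_congr rfl fun j _ => ?_
    rw [mul_assoc, Complex.re_ofReal_mul]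
    ring
  simp only [e1]
  rw [integral_finsetSum]
  · simp only [integral_const_mul, hj, Finset.sum_mul]
    rw [integral_finsetSum _ fun j _ => ((PG.x j).mul (hM' j)).int_sq g, Finset.mul_sum]
    refine Finset.sum_congr rfl fun j _ => ?_
    ring
  · intro j _
    refine Integrable.const_mul ?_ _
    have hi3 := (((PG.const 2).mul ((PG.x j).mul hM))).int2 (∂_{eV j} g) g
    refine hi3.congr (Filter.Eventually.of_forall fun ζ => ?_)
    ring_nf

end PartC

section PartD

/-- `⟨ξ⟩^{1/(2σ+1)}` -/
def lam (σ : ℝ) (ζ : Z n) : ℝ := (1 + ‖xC ζ‖ ^ 2) ^ (1 / (2 * (2 * σ + 1)))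
/-- `λ^{2σ}` -/
def wA (σ : ℝ) (ζ : Z n) : ℝ := lam σ ζ ^ (2 * σ)
/-- the argument of the bounded multiplier -/
def wy (σ : ℝ) (ζ : Z n) : ℝ := inner ℝ (vC ζ) (xC ζ) * lam σ ζ ^ (-(2 * σ + 2))
/-- the bounded multiplier -/
def wM (σ : ℝ) (ζ : Z n) : ℝ := wA σ ζ * Real.arctan (wy σ ζ)
/-- its derivative -/
def wM' (σ : ℝ) (j : Fin n) (ζ : Z n) : ℝ :=
  wA σ ζ * (1 / (1 + wy σ ζ ^ 2) * (xC ζ j * lam σ ζ ^ (-(2 * σ + 2))))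
/-- the base of the elliptic weight -/
def wm (σ : ℝ) (ζ : Z n) : ℝ := 1 + ‖vC ζ‖ ^ 2 + lam σ ζ ^ 2
/-- the full weight -/
def wG (σ : ℝ) (ζ : Z n) : ℝ := wm σ ζ ^ σ
/-- its derivative -/
def wG' (σ : ℝ) (j : Fin n) (ζ : Z n) : ℝ := (2 * vC ζ j) * σ * wm σ ζ ^ (σ - 1)

variable {σ : ℝ}

lemma lam_ge (hσ : 0 < σ) (ζ : Z n) : 1 ≤ lam σ ζ :=
  Real.one_le_rpow (by nlinarith [sq_nonneg ‖xC ζ‖]) (by positivity)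

lemma lam_pos (hσ : 0 < σ) (ζ : Z n) : 0 < lam σ ζ := by linarith [lam_ge hσ ζ]

lemma lam_pow (hσ : 0 < σ) (ζ : Z n) : lam σ ζ ^ (2 * (2 * σ + 1)) = 1 + ‖xC ζ‖ ^ 2 := by
  rw [lam, ← Real.rpow_mul (by positivity), one_div, inv_mul_cancel₀ (by positivity), Real.rpow_one]

lemma wA_ge (hσ : 0 < σ) (ζ : Z n) : 1 ≤ wA σ ζ :=
  Real.one_le_rpow (lam_ge hσ ζ) (by positivity)

lemma wm_ge (ζ : Z n) : 1 ≤ wm σ ζ := by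
  unfold wm; nlinarith [sq_nonneg ‖vC ζ‖, sq_nonneg (lam σ ζ)]

lemma wG_ge (hσ : 0 < σ) (ζ : Z n) : 1 ≤ wG σ ζ :=
  Real.one_le_rpow (wm_ge ζ) (by positivity)

lemma PG.lam : PG (lam σ : Z n → ℝ) :=
  ((PG.const 1).add (PG.xn.pow 2)).rpow (fun ζ => by nlinarith [sq_nonneg ‖xC ζ‖]) _

lemma PG.wA (hσ : 0 < σ) : PG (wA σ : Z n → ℝ) := PG.lam.rpow (lam_ge hσ) _

lemma PG.wm : PG (wm σ : Z n → ℝ) :=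
  ((PG.const 1).add (PG.vn.pow 2)).add (PG.lam.pow 2)

lemma PG.wG : PG (wG σ : Z n → ℝ) := PG.wm.rpow wm_ge _

lemma PG.wy (hσ : 0 < σ) : PG (wy σ : Z n → ℝ) := PG.inner.mul (PG.lam.rpow (lam_ge hσ) _)

lemma arctan_le (y : ℝ) : |Real.arctan y| ≤ 2 := by
  have h1 := Real.arctan_lt_pi_div_two y
  have h2 := Real.neg_pi_div_two_lt_arctan y
  have := Real.pi_lt_four
  rw [abs_le]; constructor <;> linarith

lemma PG.wM (hσ : 0 < σ) : PG (wM σ : Z n → ℝ) := by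
  refine (PG.wA hσ).mul (PG.of_le ?_ (PG.const 2) fun ζ => arctan_le _)
  exact Real.continuous_arctan.comp (PG.wy hσ).1

lemma PG.wM' (hσ : 0 < σ) (j : Fin n) : PG (wM' σ j : Z n → ℝ) := by
  refine (PG.wA hσ).mul (PG.mul (PG.of_le ?_ (PG.const 1) fun ζ => ?_)
    ((PG.x j).mul (PG.lam.rpow (lam_ge hσ) _)))
  · refine continuous_const.div (continuous_const.add ((PG.wy hσ).1.pow 2)) fun ζ => ?_
    positivity
  · rw [abs_of_nonneg (by positivity), div_le_one (by positivity)]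
    nlinarith [sq_nonneg (_root_.wy σ ζ)]

lemma PG.wG' (j : Fin n) : PG (wG' σ j : Z n → ℝ) :=
  ((((PG.const 2).mul (PG.v j))).mul (PG.const σ)).mul (PG.wm.rpow wm_ge _)

lemma lam_add (ζ : Z n) (t : ℝ) (j : Fin n) : lam σ (ζ + t • eV j) = lam σ ζ := by
  simp only [lam, xC_add_eV]

lemma wA_add (ζ : Z n) (t : ℝ) (j : Fin n) : wA σ (ζ + t • eV j) = wA σ ζ := by
  simp only [wA, lam_add]

lemma wA_deriv (j : Fin n) (ζ : Z n) : HasLineDerivAt ℝ (wA σ) 0 ζ (eV j) := by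
  unfold HasLineDerivAt
  simp only [wA_add]
  exact hasDerivAt_const _ _

lemma wM_deriv (j : Fin n) (ζ : Z n) : HasLineDerivAt ℝ (wM σ) (wM' σ j ζ) ζ (eV j) := by
  unfold HasLineDerivAt
  simp only [wM, wA_add]
  have hy : HasDerivAt (fun t : ℝ => wy σ (ζ + t • eV j))
      (xC ζ j * lam σ ζ ^ (-(2 * σ + 2))) 0 := by
    have e : ∀ t : ℝ, wy σ (ζ + t • eV j)
        = (inner ℝ (vC ζ) (xC ζ) + t * xC ζ j) * lam σ ζ ^ (-(2 * σ + 2)) := by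
      intro t
      rw [wy, lam_add, vC_add_eV, xC_add_eV, inner_add_left, inner_smul_left,
        EuclideanSpace.inner_single_left]
      simp
    simp only [e]
    have := (((hasDerivAt_id (0:ℝ)).mul_const (xC ζ j)).const_add
      (inner ℝ (vC ζ) (xC ζ))).mul_const (lam σ ζ ^ (-(2 * σ + 2)))
    simpa using this
  have := (hy.arctan).const_mul (wA σ ζ)
  simpa [wM'] using this

lemma wG_deriv (j : Fin n) (ζ : Z n) : HasLineDerivAt ℝ (wG σ) (wG' σ j ζ) ζ (eV j) := by
  unfold HasLineDerivAt
  have hy : HasDerivAt (fun t : ℝ => wm σ (ζ + t • eV j)) (2 * vC ζ j) 0 := by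
    have e : ∀ t : ℝ, wm σ (ζ + t • eV j)
        = (1 + ‖vC ζ‖ ^ 2 + lam σ ζ ^ 2) + (t * (2 * vC ζ j) + t ^ 2) := by
      intro t
      rw [wm, lam_add, vC_add_eV, norm_add_sq_real, inner_smul_right,
        EuclideanSpace.inner_single_right, norm_smul]
      simp
      ring
    simp only [e]
    have := (((hasDerivAt_id (0:ℝ)).mul_const (2 * vC ζ j)).add
      ((hasDerivAt_id (0:ℝ)).pow 2)).const_add (1 + ‖vC ζ‖ ^ 2 + lam σ ζ ^ 2)
    convert! this using 1
    simp
  have := hy.rpow_const (p := σ) (Or.inl (by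
    simp only [zero_smul, add_zero]; linarith [wm_ge (σ := σ) ζ]))
  simpa [wG', wG] using this

lemma sum_x_sq (ζ : Z n) : ∑ j, xC ζ j * xC ζ j = ‖xC ζ‖ ^ 2 := by
  rw [EuclideanSpace.norm_sq_eq]
  refine Finset.sum_congr rfl fun j _ => ?_
  rw [Real.norm_eq_abs, sq_abs, sq]

lemma wA_sq_eq (hσ : 0 < σ) (ζ : Z n) :
    wA σ ζ * lam σ ζ ^ (-(2 * σ + 2)) * ‖xC ζ‖ ^ 2 = wA σ ζ ^ 2 - lam σ ζ ^ (-2 : ℝ) := by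
  have hl := lam_pos hσ ζ
  have h1 : ‖xC ζ‖ ^ 2 = lam σ ζ ^ (2 * (2 * σ + 1)) - 1 := by rw [lam_pow hσ]; ring
  rw [h1, wA, mul_sub, mul_one, ← Real.rpow_add hl, ← Real.rpow_add hl, sq, ← Real.rpow_add hl]
  ring_nf

lemma wM_lower (hσ : 0 < σ) (ζ : Z n) :
    wA σ ζ ^ 2 / (1 + wy σ ζ ^ 2) - 1 ≤ ∑ j, xC ζ j * wM' σ j ζ := by
  have e : ∑ j, xC ζ j * wM' σ j ζ = (wA σ ζ ^ 2 - lam σ ζ ^ (-2 : ℝ)) / (1 + wy σ ζ ^ 2) := by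
    rw [← wA_sq_eq hσ, ← sum_x_sq, Finset.mul_sum, Finset.sum_div]
    refine Finset.sum_congr rfl fun j _ => ?_
    unfold wM'
    ring
  rw [e, sub_div]
  have h1 : lam σ ζ ^ (-2 : ℝ) ≤ 1 :=
    Real.rpow_le_one_of_one_le_of_nonpos (lam_ge hσ ζ) (by norm_num)
  have : lam σ ζ ^ (-2 : ℝ) / (1 + wy σ ζ ^ 2) ≤ 1 := by
    rw [div_le_one (by positivity)]
    nlinarith [sq_nonneg (wy σ ζ)]
  linarith

lemma xC_le_lam (hσ : 0 < σ) (ζ : Z n) : ‖xC ζ‖ ≤ wA σ ζ * lam σ ζ := by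
  have hl := lam_pos hσ ζ
  refine le_of_sq_le_sq ?_ (by have := wA_ge hσ ζ; positivity)
  have e : (wA σ ζ * lam σ ζ) ^ 2 = 1 + ‖xC ζ‖ ^ 2 := by
    rw [← lam_pow hσ, wA, ← Real.rpow_add_one hl.ne', ← Real.rpow_natCast, ← Real.rpow_mul hl.le]
    congr 1; push_cast; ring
  rw [e]; linarith

lemma wG'_upper (hσ : 0 < σ) (hσ1 : σ < 1) (ζ : Z n) :
    |∑ j, xC ζ j * wG' σ j ζ| ≤ 2 * wA σ ζ * wG σ ζ := by
  have hm := wm_ge (σ := σ) ζ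
  have hm0 : 0 < wm σ ζ := by linarith
  have e : ∑ j, xC ζ j * wG' σ j ζ = 2 * σ * wm σ ζ ^ (σ - 1) * inner ℝ (vC ζ) (xC ζ) := by
    rw [PiLp.inner_apply, Finset.mul_sum]
    refine Finset.sum_congr rfl fun j _ => ?_
    unfold wG'
    simp
    ring
  have hin : |inner ℝ (vC ζ) (xC ζ)| ≤ wA σ ζ * wm σ ζ := by
    have hA := wA_ge hσ ζ
    calc _ ≤ ‖vC ζ‖ * ‖xC ζ‖ := abs_real_inner_le_norm _ _
      _ ≤ ‖vC ζ‖ * (wA σ ζ * lam σ ζ) := by gcongr; exact xC_le_lam hσ ζ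
      _ = wA σ ζ * (‖vC ζ‖ * lam σ ζ) := by ring
      _ ≤ _ := by
        gcongr
        unfold wm
        nlinarith [sq_nonneg (‖vC ζ‖ - lam σ ζ), sq_nonneg ‖vC ζ‖, sq_nonneg (lam σ ζ)]
  have hG : wG σ ζ = wm σ ζ ^ (σ - 1) * wm σ ζ := by
    rw [wG, ← Real.rpow_add_one hm0.ne']; congr 1; ring
  have hp : 0 < wm σ ζ ^ (σ - 1) := Real.rpow_pos_of_pos hm0 _
  rw [e, abs_mul, abs_of_pos (by positivity), hG]
  have hA := wA_ge hσ ζ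
  calc _ ≤ 2 * σ * wm σ ζ ^ (σ - 1) * (wA σ ζ * wm σ ζ) := by gcongr
    _ ≤ 2 * 1 * wm σ ζ ^ (σ - 1) * (wA σ ζ * wm σ ζ) := by gcongr
    _ = _ := by ring

lemma Fsym_nonneg {w : E n → ℝ} (hw01 : ∀ η, 0 ≤ w η ∧ w η ≤ 1) (η : E n) : 0 ≤ Fsym σ w η := by
  have := hw01 η
  have h1 : 0 ≤ ‖η‖ ^ (2 * σ) := by positivity
  have : 0 ≤ 1 - w η := by linarith
  unfold Fsym
  have := (hw01 η).1
  positivity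

lemma Fsym_near {w : E n → ℝ} (hw01 : ∀ η, 0 ≤ w η ∧ w η ≤ 1)
    (hwout : ∀ η : E n, 2 ≤ ‖η‖ → w η = 1) (hσ : 0 < σ) (hσ1 : σ < 1) (η : E n) :
    |Fsym σ w η - ‖η‖ ^ (2 * σ)| ≤ 4 := by
  by_cases h : 2 ≤ ‖η‖
  · simp [Fsym, hwout η h]
  · push Not at h
    have e : Fsym σ w η - ‖η‖ ^ (2 * σ) = (‖η‖ ^ 2 - ‖η‖ ^ (2 * σ)) * (1 - w η) := by
      unfold Fsym; ring
    have h1 : 0 ≤ ‖η‖ ^ (2 * σ) := by positivity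
    have h2 : ‖η‖ ^ (2 * σ) ≤ 4 := by
      calc _ ≤ (2:ℝ) ^ (2 * σ) := Real.rpow_le_rpow (norm_nonneg _) h.le (by positivity)
        _ ≤ 2 ^ (2 : ℝ) := Real.rpow_le_rpow_of_exponent_le (by norm_num) (by linarith)
        _ = 4 := by norm_num
    have h3 : ‖η‖ ^ 2 ≤ 4 := by nlinarith [norm_nonneg η]
    have h4 := hw01 η
    rw [e, abs_mul]
    have h5 : |1 - w η| ≤ 1 := by rw [abs_le]; constructor <;> linarith
    have h6 : |‖η‖ ^ 2 - ‖η‖ ^ (2 * σ)| ≤ 4 := by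
      rw [abs_le]; constructor <;> nlinarith [sq_nonneg ‖η‖]
    calc _ ≤ 4 * 1 := mul_le_mul h6 h5 (abs_nonneg _) (by norm_num)
      _ = 4 := by norm_num

lemma PG.F (hσ : 0 < σ) {w : E n → ℝ} (hw : Continuous w) (hw01 : ∀ η, 0 ≤ w η ∧ w η ≤ 1) :
    PG (fun ζ : Z n => Fsym σ w (vC ζ)) := by
  have h1 : PG (fun ζ : Z n => w (vC ζ)) :=
    PG.of_le (hw.comp vC_cont) (PG.const 1) fun ζ => by
      rw [abs_of_nonneg (hw01 _).1]; exact (hw01 _).2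
  have h2 : PG (fun ζ : Z n => 1 - w (vC ζ)) :=
    PG.of_le (continuous_const.sub (hw.comp vC_cont)) (PG.const 1) fun ζ => by
      rw [abs_of_nonneg (by linarith [(hw01 (vC ζ)).2])]; linarith [(hw01 (vC ζ)).1]
  exact ((PG.vn.rpow0 (fun _ => norm_nonneg _) (by positivity)).mul h1).add
    ((PG.vn.pow 2).mul h2)

lemma vpow_le (hσ : 0 < σ) (ζ : Z n) : ‖vC ζ‖ ^ (2 * σ) ≤ wG σ ζ := by
  rw [wG, Real.rpow_mul (norm_nonneg _), Real.rpow_two]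
  refine Real.rpow_le_rpow (by positivity) ?_ hσ.le
  unfold wm; nlinarith [sq_nonneg (lam σ ζ)]

lemma wA_le_wG (hσ : 0 < σ) (ζ : Z n) : wA σ ζ ≤ wG σ ζ := by
  rw [wG, wA, Real.rpow_mul (lam_pos hσ ζ).le, Real.rpow_two]
  refine Real.rpow_le_rpow (by positivity) ?_ hσ.le
  unfold wm; nlinarith [sq_nonneg ‖vC ζ‖]

lemma xpow_le (hσ : 0 < σ) (ζ : Z n) : ‖xC ζ‖ ^ (2 * σ / (2 * σ + 1)) ≤ wA σ ζ := by
  have hl := lam_pos hσ ζ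
  have h1 : ‖xC ζ‖ ≤ lam σ ζ ^ (2 * σ + 1) := by
    rw [Real.rpow_add_one hl.ne']; exact xC_le_lam hσ ζ
  calc _ ≤ (lam σ ζ ^ (2 * σ + 1)) ^ (2 * σ / (2 * σ + 1)) :=
        Real.rpow_le_rpow (norm_nonneg _) h1 (by positivity)
    _ = _ := by
        rw [← Real.rpow_mul hl.le, wA]; congr 1; field_simp

lemma wG_upper (hσ : 0 < σ) (hσ1 : σ < 1) (ζ : Z n) :
    wG σ ζ ≤ 1 + ‖vC ζ‖ ^ (2 * σ) + wA σ ζ := by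
  rw [wG, wA, Real.rpow_mul (lam_pos hσ ζ).le, Real.rpow_two, Real.rpow_mul (norm_nonneg _),
    Real.rpow_two]
  unfold wm
  calc _ ≤ (1 + ‖vC ζ‖ ^ 2) ^ σ + (lam σ ζ ^ 2) ^ σ :=
        Real.rpow_add_le_add_rpow (by positivity) (by positivity) hσ.le hσ1.le
    _ ≤ (1 : ℝ) ^ σ + (‖vC ζ‖ ^ 2) ^ σ + (lam σ ζ ^ 2) ^ σ := by
        gcongr
        exact Real.rpow_add_le_add_rpow (by positivity) (by positivity) hσ.le hσ1.le
    _ = _ := by rw [Real.one_rpow]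

lemma lam_le_v (hσ : 0 < σ) (ζ : Z n) (h : 1 < |wy σ ζ|) : lam σ ζ ≤ ‖vC ζ‖ := by
  have hl := lam_pos hσ ζ
  by_contra hc
  push Not at hc
  have h1 : |inner ℝ (vC ζ) (xC ζ)| ≤ lam σ ζ * (wA σ ζ * lam σ ζ) :=
    (abs_real_inner_le_norm _ _).trans
      (mul_le_mul hc.le (xC_le_lam hσ ζ) (norm_nonneg _) hl.le)
  have h2 : lam σ ζ * (wA σ ζ * lam σ ζ) = lam σ ζ ^ (2 * σ + 2) := by
    rw [wA, Real.rpow_add hl, Real.rpow_two]; ring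
  rw [wy, abs_mul, Real.rpow_neg hl.le, abs_of_pos (a := (_)⁻¹) (by positivity)] at h
  rw [h2] at h1
  rw [← div_eq_mul_inv, one_lt_div (by positivity)] at h
  linarith

lemma wA_split (hσ : 0 < σ) (ζ : Z n) :
    wA σ ζ ^ 2 ≤ 2 * (wA σ ζ ^ 2 / (1 + wy σ ζ ^ 2)) + wA σ ζ * ‖vC ζ‖ ^ (2 * σ) := by
  have hA := wA_ge hσ ζ
  by_cases h : 1 < |wy σ ζ|
  · have h1 := lam_le_v hσ ζ h
    have h2 : wA σ ζ ≤ ‖vC ζ‖ ^ (2 * σ) :=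
      Real.rpow_le_rpow (lam_pos hσ ζ).le h1 (by positivity)
    have : 0 ≤ wA σ ζ ^ 2 / (1 + wy σ ζ ^ 2) := by positivity
    nlinarith
  · push Not at h
    have h1 : wy σ ζ ^ 2 ≤ 1 := by rw [← sq_abs]; nlinarith [abs_nonneg (wy σ ζ)]
    have h2 : wA σ ζ ^ 2 / 2 ≤ wA σ ζ ^ 2 / (1 + wy σ ζ ^ 2) := by
      gcongr; linarith
    have h3 : 0 ≤ ‖vC ζ‖ ^ (2 * σ) := by positivity
    nlinarith

end PartD

section PartE

/-- hypotheses on the cutoff bundled -/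
structure WH (σ : ℝ) (w : E n → ℝ) : Prop where
  s0 : 0 < σ
  s1 : σ < 1
  c : Continuous w
  b : ∀ η, 0 ≤ w η ∧ w η ≤ 1
  o : ∀ η : E n, 2 ≤ ‖η‖ → w η = 1

variable {σ : ℝ} {w : E n → ℝ}

lemma re_le (x y : ℂ) : (x * (starRingEnd ℂ) y).re ≤ ‖x‖ * ‖y‖ :=
  (Complex.re_le_norm _).trans (by simp)

lemma pair_bound {f : Z n → ℂ} (hf : L2 f) (g : SchwartzMap (Z n) ℂ) {M N : Z n → ℝ} (hN : PG N)
    (C : ℝ) (hC : 0 ≤ C) (hMN : ∀ ζ, |M ζ| ≤ C * N ζ)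
    (hI : Integrable (fun ζ => M ζ * (f ζ * (starRingEnd ℂ) (g ζ)).re)) :
    |∫ ζ, M ζ * (f ζ * (starRingEnd ℂ) (g ζ)).re| ≤ C * (nrm f * nrm (fun ζ => (N ζ : ℂ) * g ζ)) := by
  have hI2 := hf.mul_int (hN.memL2 g)
  calc _ ≤ ∫ ζ, |M ζ * (f ζ * (starRingEnd ℂ) (g ζ)).re| := abs_integral_le_integral_abs
    _ ≤ ∫ ζ, C * (‖f ζ‖ * ‖(N ζ : ℂ) * g ζ‖) := by
        refine integral_mono hI.abs (hI2.const_mul C) fun ζ => ?_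
        simp only [abs_mul, norm_mul, Complex.norm_real, Real.norm_eq_abs]
        have h1 : |(f ζ * (starRingEnd ℂ) (g ζ)).re| ≤ ‖f ζ‖ * ‖g ζ‖ :=
          (Complex.abs_re_le_norm _).trans (by simp)
        calc _ ≤ (C * |N ζ|) * (‖f ζ‖ * ‖g ζ‖) := by
              gcongr
              exact (hMN ζ).trans (by gcongr; exact le_abs_self _)
          _ = _ := by ring
    _ ≤ _ := by
        rw [integral_const_mul]
        gcongr
        exact cs hf (hN.memL2 g)


lemma energyF (hW : WH σ w) (c : ℝ) (g : SchwartzMap (Z n) ℂ)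
    {M : Z n → ℝ} {M' : Fin n → Z n → ℝ} (hM : PG M) (hM' : ∀ j, PG (M' j))
    (hd : ∀ j ζ, HasLineDerivAt ℝ M (M' j ζ) ζ (eV j)) :
      Integrable (fun ζ => M ζ * ((hS g ζ + (c : ℂ) * ((Fsym σ w (vC ζ) : ℂ) * g ζ)) *
        (starRingEnd ℂ) (g ζ)).re) ∧
      ∫ ζ, M ζ * ((hS g ζ + (c : ℂ) * ((Fsym σ w (vC ζ) : ℂ) * g ζ)) * (starRingEnd ℂ) (g ζ)).re
      = 1 / 2 * (∫ ζ, (∑ j, xC ζ j * M' j ζ) * ‖g ζ‖ ^ 2)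
        + c * ∫ ζ, (M ζ * Fsym σ w (vC ζ)) * ‖g ζ‖ ^ 2 := by
  have hF : PG (fun ζ : Z n => Fsym σ w (vC ζ)) := PG.F hW.s0 hW.c hW.b
  have hi1 : Integrable (fun ζ => M ζ * (hS g ζ * (starRingEnd ℂ) (g ζ)).re) := by
    have h1 := (hS_L2 g).mul_int (hM.memL2 g)
    refine h1.mono ?_ (Filter.Eventually.of_forall fun ζ => ?_)
    · refine hM.1.aestronglyMeasurable.mul ?_
      exact Complex.continuous_re.comp_aestronglyMeasurable
        ((hS_L2 g).1.mul (Complex.continuous_conj.comp g.continuous).aestronglyMeasurable)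
    · simp only [norm_mul, Complex.norm_real, norm_norm]
      have h1 : ‖(hS g ζ * (starRingEnd ℂ) (g ζ)).re‖ ≤ ‖hS g ζ‖ * ‖g ζ‖ :=
        (Complex.abs_re_le_norm _).trans (by simp)
      calc _ ≤ ‖M ζ‖ * (‖hS g ζ‖ * ‖g ζ‖) := by gcongr
        _ = _ := by ring
  have hi2 : Integrable (fun ζ => c * ((M ζ * Fsym σ w (vC ζ)) * ‖g ζ‖ ^ 2)) :=
    ((hM.mul hF).int_sq g).const_mul c
  have e : (fun ζ => M ζ * ((hS g ζ + (c : ℂ) * ((Fsym σ w (vC ζ) : ℂ) * g ζ)) * (starRingEnd ℂ) (g ζ)).re) =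
      fun ζ => M ζ * (hS g ζ * (starRingEnd ℂ) (g ζ)).re
        + c * ((M ζ * Fsym σ w (vC ζ)) * ‖g ζ‖ ^ 2) := by
    ext ζ
    have : (c : ℂ) * ((Fsym σ w (vC ζ) : ℂ) * g ζ) * (starRingEnd ℂ) (g ζ)
        = ((c * (Fsym σ w (vC ζ) * ‖g ζ‖ ^ 2) : ℝ) : ℂ) := by
      rw [mul_assoc, mul_assoc, Complex.mul_conj, Complex.normSq_eq_norm_sq]; push_cast; ring
    simp only [add_mul, Complex.add_re]
    rw [this, Complex.ofReal_re]
    ring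
  rw [e]
  refine ⟨hi1.add hi2, ?_⟩
  rw [integral_add hi1 hi2, energy g hM hM' hd, integral_const_mul]

lemma arith_cc {c₀ c a G φ γ I1 I2 I4 D2 J2 D4 : ℝ} (hc₀ : 0 < c₀) (hc : c₀ ≤ c)
    (ha0 : 0 ≤ a) (hG0 : 0 ≤ G) (hφ0 : 0 ≤ φ) (hγ0 : 0 ≤ γ) (hγa : γ ≤ a)
    (b1 : c * I1 ≤ φ * a) (b2 : 1 / 2 * D2 + c * J2 ≤ 2 * (φ * a)) (c2 : -(2 * I1) ≤ J2)
    (d2 : I2 - γ ^ 2 ≤ D2) (f3 : a ^ 2 ≤ 2 * I2 + I1 + 4 * (a * γ))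
    (b4 : 1 / 2 * D4 + c * I4 ≤ φ * G) (c4 : -(2 * (a * G)) ≤ D4)
    (f4 : G ^ 2 ≤ I4 + 6 * (a * G)) :
    G ≤ (100 * (1 + 1 / c₀) ^ 2) * (φ + γ) := by
  have hcp : 0 < c := by linarith
  have hk : I1 ≤ 1 / c₀ * (φ * a) := by
    have : I1 ≤ 1 / c * (φ * a) := by
      rw [div_mul_eq_mul_div, one_mul, le_div_iff₀ hcp]; linarith
    exact this.trans (by gcongr)
  have hcI : -(2 * (φ * a)) ≤ c * J2 := by
    have := mul_le_mul_of_nonneg_left c2 hcp.le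
    linarith
  have g2 : I2 ≤ 8 * (φ * a) + γ ^ 2 := by linarith
  have g4 : I4 ≤ 1 / c₀ * ((φ + a) * G) := by
    have : I4 ≤ 1 / c * ((φ + a) * G) := by
      rw [div_mul_eq_mul_div, one_mul, le_div_iff₀ hcp]; linarith
    exact this.trans (by gcongr)
  have hk0 : 0 < 1 / c₀ := by positivity
  generalize 1 / c₀ = k at *
  have g3 : a ≤ (16 + k) * φ + 6 * γ := by
    have : a * a ≤ a * ((16 + k) * φ + 6 * γ) := by nlinarith
    rcases eq_or_lt_of_le ha0 with h | h
    · rw [← h]; positivity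
    · exact le_of_mul_le_mul_left this h
  have g5 : G ≤ k * (φ + a) + 6 * a := by
    have : G * G ≤ G * (k * (φ + a) + 6 * a) := by linarith
    rcases eq_or_lt_of_le hG0 with h | h
    · rw [← h]; positivity
    · exact le_of_mul_le_mul_left this h
  calc G ≤ k * (φ + a) + 6 * a := g5
    _ = k * φ + (k + 6) * a := by ring
    _ ≤ k * φ + (k + 6) * ((16 + k) * φ + 6 * γ) := by gcongr
    _ ≤ _ := by nlinarith [mul_nonneg hk0.le hφ0, mul_nonneg hk0.le hγ0,
        mul_nonneg (sq_nonneg k) hφ0, mul_nonneg (sq_nonneg k) hγ0]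

lemma PGq (hσ : 0 < σ) : PG (fun ζ : Z n => wA σ ζ ^ 2 / (1 + wy σ ζ ^ 2)) := by
  refine PG.of_le ?_ ((PG.wA hσ).pow 2) fun ζ => ?_
  · refine ((PG.wA hσ).1.pow 2).div (continuous_const.add ((PG.wy hσ).1.pow 2)) fun ζ => ?_
    positivity
  · rw [abs_of_nonneg (by positivity)]
    exact div_le_self (by positivity) (by linarith [sq_nonneg (_root_.wy σ ζ)])

lemma cc_c2 (hW : WH σ w) (g : SchwartzMap (Z n) ℂ) :
    -(2 * ∫ ζ, (wA σ ζ * Fsym σ w (vC ζ)) * ‖g ζ‖ ^ 2) ≤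
      ∫ ζ, (wM σ ζ * Fsym σ w (vC ζ)) * ‖g ζ‖ ^ 2 := by
  have hσ := hW.s0
  have hF : PG (fun ζ : Z n => Fsym σ w (vC ζ)) := PG.F hσ hW.c hW.b
  have hA := PG.wA (n := n) hσ
  rw [← integral_const_mul, ← integral_neg]
  refine integral_mono (((hA.mul hF).int_sq g).const_mul 2).neg (((PG.wM hσ).mul hF).int_sq g)
    fun ζ => ?_
  have h1 := (abs_le.1 (arctan_le (wy σ ζ))).1
  have h2 : 0 ≤ wA σ ζ * Fsym σ w (vC ζ) * ‖g ζ‖ ^ 2 := by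
    have := Fsym_nonneg (σ := σ) hW.b (vC ζ); have := wA_ge hσ ζ; positivity
  simp only [wM]
  have := mul_le_mul_of_nonneg_left h1 h2
  linarith

lemma cc_d2 (hσ : 0 < σ) (g : SchwartzMap (Z n) ℂ) :
    (∫ ζ, (wA σ ζ ^ 2 / (1 + wy σ ζ ^ 2)) * ‖g ζ‖ ^ 2) - nrm g ^ 2
      ≤ ∫ ζ, (∑ j, xC ζ j * wM' σ j ζ) * ‖g ζ‖ ^ 2 := by
  have hgL : L2 (g : Z n → ℂ) := g.memLp 2
  rw [nrm_sq hgL, ← integral_sub ((PGq hσ).int_sq g) hgL.sq_int]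
  refine integral_mono (((PGq hσ).int_sq g).sub hgL.sq_int)
    ((PG.sum _ fun j => (PG.x j).mul (PG.wM' hσ j)).int_sq g) fun ζ => ?_
  have h1 := wM_lower hσ ζ
  have h3 : 0 ≤ ‖g ζ‖ ^ 2 := by positivity
  have := mul_le_mul_of_nonneg_right h1 h3
  simp only
  linarith

lemma F_v (hW : WH σ w) (ζ : Z n) : ‖vC ζ‖ ^ (2 * σ) ≤ Fsym σ w (vC ζ) + 4 := by
  have := abs_le.1 (Fsym_near hW.b hW.o hW.s0 hW.s1 (vC ζ)); linarith [this.1]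

lemma nrm_ofR {x : ℝ} (hx : 1 ≤ x) (z : ℂ) : ‖(x : ℂ) * z‖ = x * ‖z‖ := by
  rw [norm_mul, Complex.norm_real, Real.norm_eq_abs, abs_of_nonneg (by linarith)]

lemma cc_f3 (hW : WH σ w) (g : SchwartzMap (Z n) ℂ) :
    nrm (fun ζ => (wA σ ζ : ℂ) * g ζ) ^ 2 ≤
      2 * (∫ ζ, (wA σ ζ ^ 2 / (1 + wy σ ζ ^ 2)) * ‖g ζ‖ ^ 2)
      + (∫ ζ, (wA σ ζ * Fsym σ w (vC ζ)) * ‖g ζ‖ ^ 2)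
      + 4 * (nrm (fun ζ => (wA σ ζ : ℂ) * g ζ) * nrm g) := by
  have hσ := hW.s0
  have hF : PG (fun ζ : Z n => Fsym σ w (vC ζ)) := PG.F hσ hW.c hW.b
  have hA := PG.wA (n := n) hσ
  have hgL : L2 (g : Z n → ℂ) := g.memLp 2
  have hAγ := cs (hA.memL2 g) hgL
  have hAγi := (hA.memL2 g).mul_int hgL
  have i1 : Integrable (fun ζ => 2 * ((wA σ ζ ^ 2 / (1 + wy σ ζ ^ 2)) * ‖g ζ‖ ^ 2)) :=
    ((PGq hσ).int_sq g).const_mul 2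
  have i2 : Integrable (fun ζ => (wA σ ζ * Fsym σ w (vC ζ)) * ‖g ζ‖ ^ 2) := (hA.mul hF).int_sq g
  have i3 : Integrable (fun ζ => 4 * (‖(wA σ ζ : ℂ) * g ζ‖ * ‖g ζ‖)) := hAγi.const_mul 4
  have i12 : Integrable (fun ζ => 2 * ((wA σ ζ ^ 2 / (1 + wy σ ζ ^ 2)) * ‖g ζ‖ ^ 2)
            + (wA σ ζ * Fsym σ w (vC ζ)) * ‖g ζ‖ ^ 2) := i1.add i2
  calc _ = ∫ ζ, ‖(wA σ ζ : ℂ) * g ζ‖ ^ 2 := nrm_sq (hA.memL2 g)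
    _ ≤ ∫ ζ, (2 * ((wA σ ζ ^ 2 / (1 + wy σ ζ ^ 2)) * ‖g ζ‖ ^ 2)
          + (wA σ ζ * Fsym σ w (vC ζ)) * ‖g ζ‖ ^ 2 + 4 * (‖(wA σ ζ : ℂ) * g ζ‖ * ‖g ζ‖)) := by
        refine integral_mono (hA.memL2 g).sq_int (i12.add i3) fun ζ => ?_
        have h0 := wA_ge hσ ζ
        have h1 := wA_split hσ ζ
        have h2 := mul_le_mul_of_nonneg_left (F_v hW ζ) (by linarith : 0 ≤ wA σ ζ)
        have h3 : 0 ≤ ‖g ζ‖ ^ 2 := by positivity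
        simp only [nrm_ofR h0]
        have h4 := mul_le_mul_of_nonneg_right (h1.trans (add_le_add_right h2 _)) h3
        linarith
    _ ≤ _ := by
        rw [integral_add i12 i3, integral_add i1 i2, integral_const_mul, integral_const_mul]
        linarith

lemma cc_c4 (hW : WH σ w) (g : SchwartzMap (Z n) ℂ) :
    -(2 * (nrm (fun ζ => (wA σ ζ : ℂ) * g ζ) * nrm (fun ζ => (wG σ ζ : ℂ) * g ζ))) ≤
      ∫ ζ, (∑ j, xC ζ j * wG' σ j ζ) * ‖g ζ‖ ^ 2 := by
  have hσ := hW.s0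
  have hA := PG.wA (n := n) hσ
  have hAGi := (hA.memL2 g).mul_int ((PG.wG (σ := σ)).memL2 g)
  have hAG := cs (hA.memL2 g) ((PG.wG (σ := σ)).memL2 g)
  refine le_trans (neg_le_neg (mul_le_mul_of_nonneg_left hAG zero_le_two)) ?_
  rw [← integral_const_mul, ← integral_neg]
  refine integral_mono (hAGi.const_mul 2).neg
    ((PG.sum _ fun j => (PG.x j).mul (PG.wG' j)).int_sq g) fun ζ => ?_
  have h1 := (abs_le.1 (wG'_upper hσ hW.s1 ζ)).1
  have h3 : 0 ≤ ‖g ζ‖ ^ 2 := by positivity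
  have h4 := mul_le_mul_of_nonneg_right h1 h3
  simp only [nrm_ofR (wA_ge hσ ζ), nrm_ofR (wG_ge hσ ζ)]
  linarith

lemma cc_f4 (hW : WH σ w) (g : SchwartzMap (Z n) ℂ) :
    nrm (fun ζ => (wG σ ζ : ℂ) * g ζ) ^ 2 ≤
      (∫ ζ, (wG σ ζ * Fsym σ w (vC ζ)) * ‖g ζ‖ ^ 2)
      + 6 * (nrm (fun ζ => (wA σ ζ : ℂ) * g ζ) * nrm (fun ζ => (wG σ ζ : ℂ) * g ζ)) := by
  have hσ := hW.s0
  have hF : PG (fun ζ : Z n => Fsym σ w (vC ζ)) := PG.F hσ hW.c hW.b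
  have hA := PG.wA (n := n) hσ
  have hAGi := (hA.memL2 g).mul_int ((PG.wG (σ := σ)).memL2 g)
  have hAG := cs (hA.memL2 g) ((PG.wG (σ := σ)).memL2 g)
  have i1 : Integrable (fun ζ => (wG σ ζ * Fsym σ w (vC ζ)) * ‖g ζ‖ ^ 2) :=
    (PG.wG.mul hF).int_sq g
  have i2 : Integrable (fun ζ => 6 * (‖(wA σ ζ : ℂ) * g ζ‖ * ‖(wG σ ζ : ℂ) * g ζ‖)) :=
    hAGi.const_mul 6
  calc _ = ∫ ζ, ‖(wG σ ζ : ℂ) * g ζ‖ ^ 2 := nrm_sq (PG.wG.memL2 g)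
    _ ≤ ∫ ζ, ((wG σ ζ * Fsym σ w (vC ζ)) * ‖g ζ‖ ^ 2
          + 6 * (‖(wA σ ζ : ℂ) * g ζ‖ * ‖(wG σ ζ : ℂ) * g ζ‖)) := by
        refine integral_mono (PG.wG.memL2 g).sq_int (i1.add i2) fun ζ => ?_
        have h1 := wG_upper hσ hW.s1 ζ
        have h1' : wG σ ζ ≤ Fsym σ w (vC ζ) + 6 * wA σ ζ := by linarith [wA_ge hσ ζ, F_v hW ζ]
        have h3 : 0 ≤ ‖g ζ‖ ^ 2 := by positivity
        simp only [nrm_ofR (wA_ge hσ ζ), nrm_ofR (wG_ge hσ ζ)]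
        have h4 := mul_le_mul_of_nonneg_left h1' (by linarith [wG_ge hσ ζ] : 0 ≤ wG σ ζ)
        have h5 := mul_le_mul_of_nonneg_right h4 h3
        linarith
    _ ≤ _ := by
        rw [integral_add i1 i2, integral_const_mul]
        linarith

/-- constant coefficient estimate on the Fourier side -/
lemma const_coeff (hW : WH σ w) {c₀ c : ℝ} (hc₀ : 0 < c₀) (hc : c₀ ≤ c) (g : SchwartzMap (Z n) ℂ) :
    nrm (fun ζ => (wG σ ζ : ℂ) * g ζ) ≤
      (100 * (1 + 1 / c₀) ^ 2) *
      (nrm (fun ζ => hS g ζ + (c : ℂ) * ((Fsym σ w (vC ζ) : ℂ) * g ζ)) + nrm g) := by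
  have hσ := hW.s0
  have hF : PG (fun ζ : Z n => Fsym σ w (vC ζ)) := PG.F hσ hW.c hW.b
  have hf : L2 (fun ζ => hS g ζ + (c : ℂ) * ((Fsym σ w (vC ζ) : ℂ) * g ζ)) :=
    (hS_L2 g).add ((hF.memL2 g).const_mul _)
  have hA := PG.wA (n := n) hσ
  have hAp : ∀ ζ : Z n, 1 ≤ wA σ ζ := wA_ge hσ
  have hGp : ∀ ζ : Z n, 1 ≤ wG σ ζ := wG_ge hσ
  have hγa : nrm g ≤ nrm (fun ζ => (wA σ ζ : ℂ) * g ζ) := nrm_mono1 (hA.memL2 g) fun ζ => by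
    rw [nrm_ofR (hAp ζ)]
    nlinarith [hAp ζ, norm_nonneg (g ζ)]
  obtain ⟨i1, e1⟩ := energyF hW c g hA (M' := fun _ _ => 0) (fun _ => PG.const 0)
    (fun j ζ => wA_deriv j ζ)
  have b1 := pair_bound hf g hA 1 zero_le_one (fun ζ => by
    rw [one_mul, abs_of_nonneg (by linarith [hAp ζ])]) i1
  simp only [mul_zero, Finset.sum_const_zero, zero_mul, integral_zero, zero_add, one_mul] at e1 b1
  rw [e1] at b1
  obtain ⟨i2, e2⟩ := energyF hW c g (PG.wM hσ) (PG.wM' hσ) (fun j ζ => wM_deriv j ζ)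
  have b2 := pair_bound hf g hA 2 zero_le_two (fun ζ => by
    rw [wM, abs_mul, abs_of_nonneg (by linarith [hAp ζ] : 0 ≤ wA σ ζ), mul_comm]
    exact mul_le_mul_of_nonneg_right (arctan_le _) (by linarith [hAp ζ])) i2
  rw [e2] at b2
  obtain ⟨i4, e4⟩ := energyF hW c g PG.wG (PG.wG') (fun j ζ => wG_deriv j ζ)
  have b4 := pair_bound hf g (PG.wG (σ := σ)) 1 zero_le_one (fun ζ => by
    rw [one_mul, abs_of_nonneg (by linarith [hGp ζ])]) i4
  rw [e4, one_mul] at b4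
  exact arith_cc hc₀ hc (nrm_nonneg _) (nrm_nonneg _) (nrm_nonneg _) (nrm_nonneg _) hγa
    ((le_abs_self _).trans b1) ((le_abs_self _).trans b2) (cc_c2 hW g) (cc_d2 hσ g) (cc_f3 hW g)
    ((le_abs_self _).trans b4) (cc_c4 hW g) (cc_f4 hW g)

end PartE

section PartF

/-- multiplication of Schwartz functions -/
def mulS (φ u : SchwartzMap (Z n) ℂ) : SchwartzMap (Z n) ℂ :=
  SchwartzMap.pairing (ContinuousLinearMap.mul ℂ ℂ) φ u

lemma mulS_apply (φ u : SchwartzMap (Z n) ℂ) (z : Z n) : mulS φ u z = φ z * u z := rfl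

open scoped LineDeriv in
/-- the transport operator -/
def X0 (u : SchwartzMap (Z n) ℂ) : SchwartzMap (Z n) ℂ :=
  ∂_{(eT : Z n)} u + ∑ j : Fin n, ∂_{eX j} (SchwartzMap.smulLeftCLM ℂ (fun z : Z n => inner ℝ z (eV j)) u)

lemma inner_eV (z : Z n) (j : Fin n) : inner ℝ z (eV j) = vC z j := by
  simp [eV, vC, EuclideanSpace.inner_single_right]
lemma inner_eX (z : Z n) (j : Fin n) : inner ℝ z (eX j) = xC z j := by
  simp [eX, xC, EuclideanSpace.inner_single_right]
lemma inner_eT (z : Z n) : inner ℝ z eT = tC z := by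
  simp [eT, tC, EuclideanSpace.inner_single_right]

lemma tg (m : Z n) : Function.HasTemperateGrowth (fun z : Z n => (inner ℝ z m : ℝ)) := by
  fun_prop

lemma X0_apply (u : SchwartzMap (Z n) ℂ) (z : Z n) :
    X0 u z = fderiv ℝ u z eT + ∑ i : Fin n, (vC z i : ℂ) * fderiv ℝ u z (eX i) := by
  unfold X0
  rw [add_apply, sum_apply, SchwartzMap.lineDerivOp_apply_eq_fderiv]
  congr 1
  refine Finset.sum_congr rfl fun j _ => ?_
  rw [SchwartzMap.lineDerivOp_apply_eq_fderiv]
  have e : ((SchwartzMap.smulLeftCLM ℂ (fun z : Z n => inner ℝ z (eV j)) u : SchwartzMap (Z n) ℂ) : Z n → ℂ)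
      = fun z => (inner ℝ z (eV j) : ℝ) • u z := by
    ext z; exact SchwartzMap.smulLeftCLM_apply_apply (tg _) u z
  rw [e]
  have h1 : DifferentiableAt ℝ (fun z : Z n => (inner ℝ z (eV j) : ℝ)) z :=
    differentiableAt_fun_id.inner ℝ (differentiableAt_const _)
  rw [fderiv_fun_smul h1 u.differentiableAt]
  have h2 : fderiv ℝ (fun z : Z n => (inner ℝ z (eV j) : ℝ)) z (eX j) = 0 := by
    rw [fderiv_inner_apply ℝ differentiableAt_fun_id (differentiableAt_const _)]
    simp [eX, eV, EuclideanSpace.inner_single_right]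
  simp only [add_apply, smul_apply, ContinuousLinearMap.smulRight_apply, h2, zero_smul,
    add_zero, Complex.real_smul]
  rw [inner_eV]

open FourierTransform in
lemma X0_fourier (u : SchwartzMap (Z n) ℂ) : hS (𝓕 u) = 𝓕 (X0 u) := by
  ext ζ
  unfold X0 hS
  rw [FourierTransform.fourier_add, SchwartzMap.fourier_lineDerivOp_eq, FourierTransform.fourier_sum,
    add_apply, sum_apply, sub_eq_add_neg, ← Finset.sum_neg_distrib]
  congr 1
  · rw [smul_apply, SchwartzMap.smulLeftCLM_apply_apply (tg _), inner_eT]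
    simp [mul_assoc]
  · refine Finset.sum_congr rfl fun j _ => ?_
    rw [SchwartzMap.lineDerivOp_fourier_eq, SchwartzMap.fourier_lineDerivOp_eq,
      FourierTransform.fourier_smul]
    rw [smul_apply, smul_apply, SchwartzMap.smulLeftCLM_apply_apply (tg _), inner_eX]
    simp only [smul_eq_mul, Complex.real_smul]
    ring

open FourierTransform in
lemma finv_add {f g : Z n → ℂ} (hf : Integrable f) (hg : Integrable g) :
    𝓕⁻ (fun ζ => f ζ + g ζ) = fun z => 𝓕⁻ f z + 𝓕⁻ g z := by
  ext z
  simp only [Real.fourierInv_eq]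
  rw [← integral_add ((Real.fourierIntegral_convergent_iff (-z)).2 hf |>.congr (by simp))
    ((Real.fourierIntegral_convergent_iff (-z)).2 hg |>.congr (by simp))]
  simp only [smul_add]

open FourierTransform in
lemma finv_cmul {f : Z n → ℂ} (c : ℂ) :
    𝓕⁻ (fun ζ => c * f ζ) = fun z => c * 𝓕⁻ f z := by
  ext z
  simp only [Real.fourierInv_eq]
  rw [← integral_const_mul]
  congr 1; ext v
  simp only [Circle.smul_def, smul_eq_mul]
  ring

open FourierTransform in
lemma finv_sub {f g : Z n → ℂ} (hf : Integrable f) (hg : Integrable g) :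
    𝓕⁻ (fun ζ => f ζ - g ζ) = fun z => 𝓕⁻ f z - 𝓕⁻ g z := by
  have := finv_add hf (hg.const_mul (-1))
  rw [finv_cmul] at this
  simpa [sub_eq_add_neg] using this

open FourierTransform Convolution in
lemma finv_conv {f g : Z n → ℂ} (hf : Integrable f) (hg : Integrable g) :
    𝓕⁻ (fun ζ => ∫ κ, f κ * g (ζ - κ)) = fun z => 𝓕⁻ f z * 𝓕⁻ g z := by
  ext z
  simp only [Real.fourierInv_eq_fourier_neg]
  exact Real.fourier_mul_convolution_eq hf hg (-z)

open FourierTransform Convolution in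
lemma fourier_mulS (φ u : SchwartzMap (Z n) ℂ) (ζ : Z n) :
    𝓕 (mulS φ u) ζ = ∫ κ, 𝓕 φ κ * 𝓕 u (ζ - κ) := by
  set S := SchwartzMap.convolution (ContinuousLinearMap.mul ℂ ℂ) (𝓕 φ) (𝓕 u) with hS
  have h1 : (S : Z n → ℂ) = fun ζ => ∫ κ, 𝓕 φ κ * 𝓕 u (ζ - κ) := by
    ext ζ; exact SchwartzMap.convolution_apply _ _ _ _
  have h2 : 𝓕⁻ S = mulS φ u := by
    ext z
    rw [SchwartzMap.fourierInv_coe, h1, finv_conv (𝓕 φ).integrable (𝓕 u).integrable,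
      ← SchwartzMap.fourierInv_coe, ← SchwartzMap.fourierInv_coe]
    simp [mulS_apply]
  rw [← h2, FourierTransform.fourier_fourierInv_eq, h1]

variable {σ : ℝ} {w : E n → ℝ}

open FourierTransform in
lemma fracLap_S (u : SchwartzMap (Z n) ℂ) :
    fracLap σ w u = 𝓕⁻ (fun ζ : Z n => (Fsym σ w (vC ζ) : ℂ) * 𝓕 u ζ) := rfl

lemma PGF (hW : WH σ w) : PG (fun ζ : Z n => Fsym σ w (vC ζ)) := PG.F hW.s0 hW.c hW.b

lemma fracLap_L2 (hW : WH σ w) (u : SchwartzMap (Z n) ℂ) : L2 (fracLap σ w u) := by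
  rw [fracLap_S]
  exact planchInv_memLp ((PGF hW).memL1 _) ((PGF hW).memL2 _)

open FourierTransform in
lemma nrm_fracLap (hW : WH σ w) (u : SchwartzMap (Z n) ℂ) :
    nrm (fracLap σ w u) = nrm (fun ζ : Z n => (Fsym σ w (vC ζ) : ℂ) * 𝓕 u ζ) := by
  rw [fracLap_S, nrm, nrm, planchInv ((PGF hW).memL1 _) ((PGF hW).memL2 _)]

open FourierTransform in
lemma nrm_fourier (u : SchwartzMap (Z n) ℂ) : nrm (𝓕 u : SchwartzMap (Z n) ℂ) = nrm u := by
  rw [nrm, nrm, SchwartzMap.fourier_coe, planch u.integrable (u.memLp 2)]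

open FourierTransform in
lemma const_phys (hW : WH σ w) {c₀ c : ℝ} (hc₀ : 0 < c₀) (hc : c₀ ≤ c) (u : SchwartzMap (Z n) ℂ) :
    nrm (fun ζ => (wG σ ζ : ℂ) * 𝓕 u ζ) ≤
      (100 * (1 + 1 / c₀) ^ 2) *
      (nrm (fun z => X0 u z + (c : ℂ) * fracLap σ w u z) + nrm u) := by
  have h := const_coeff hW hc₀ hc (𝓕 u)
  rw [nrm_fourier] at h
  have i1 : Integrable (hS (𝓕 u)) := hS_L1 _
  have i2 : Integrable (fun ζ : Z n => (c : ℂ) * ((Fsym σ w (vC ζ) : ℂ) * 𝓕 u ζ)) :=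
    ((PGF hW).memL1 (𝓕 u)).const_mul _
  have j2 : L2 (fun ζ : Z n => (c : ℂ) * ((Fsym σ w (vC ζ) : ℂ) * 𝓕 u ζ)) :=
    ((PGF hW).memL2 (𝓕 u)).const_mul _
  have e : (fun z => X0 u z + (c : ℂ) * fracLap σ w u z) =
      𝓕⁻ (fun ζ => hS (𝓕 u) ζ + (c : ℂ) * ((Fsym σ w (vC ζ) : ℂ) * 𝓕 u ζ)) := by
    rw [finv_add i1 i2, finv_cmul, ← fracLap_S, X0_fourier, ← SchwartzMap.fourierInv_coe,
      FourierTransform.fourierInv_fourier_eq]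
  have e2 : nrm (𝓕⁻ (fun ζ => hS (𝓕 u) ζ + (c : ℂ) * ((Fsym σ w (vC ζ) : ℂ) * 𝓕 u ζ))) =
      nrm (fun ζ => hS (𝓕 u) ζ + (c : ℂ) * ((Fsym σ w (vC ζ) : ℂ) * 𝓕 u ζ)) :=
    congrArg ENNReal.toReal (planchInv (i1.add i2) ((hS_L2 _).add j2))
  rw [e, e2]
  exact h

end PartF

section PartG

lemma young_nrm {R k g : Z n → ℂ} {r : Z n → Z n → ℂ} (hk : Continuous k) (hki : Integrable k)
    (hg : Continuous g) (hgL : L2 g) (hR : ∀ ζ, R ζ = ∫ κ, r ζ κ)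
    (h : ∀ ζ κ, ‖r ζ κ‖ ≤ ‖k κ‖ * ‖g (ζ - κ)‖) :
    eLpNorm R 2 volume < ⊤ ∧ nrm R ≤ (∫ κ, ‖k κ‖) * nrm g := by
  have h1 : eLpNorm R 2 volume ≤ (∫⁻ κ, ‖k κ‖ₑ) * eLpNorm g 2 volume := by
    refine young_eLpNorm hk.measurable hg.measurable fun ζ => ?_
    rw [hR]
    refine (enorm_integral_le_lintegral_enorm _).trans (lintegral_mono fun κ => ?_)
    rw [← enorm_norm (k κ), ← enorm_norm (g (ζ - κ)), ← enorm_mul]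
    exact enorm_le_iff_norm_le.2 ((h ζ κ).trans (le_abs_self _))
  have h2 : (∫⁻ κ, ‖k κ‖ₑ) ≠ ⊤ := hki.2.ne
  have h3 : (∫⁻ κ, ‖k κ‖ₑ) * eLpNorm g 2 volume ≠ ⊤ := ENNReal.mul_ne_top h2 hgL.2.ne
  refine ⟨lt_of_le_of_lt h1 h3.lt_top, ?_⟩
  have h4 := ENNReal.toReal_mono h3 h1
  rw [ENNReal.toReal_mul] at h4
  rwa [integral_norm_eq_lintegral_enorm hki.1]

variable {σ : ℝ} {w : E n → ℝ}

lemma rpow_diff {a b s : ℝ} (ha : 0 ≤ a) (hb : 0 ≤ b) (hs : 0 ≤ s) (hs1 : s ≤ 1) :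
    |a ^ s - b ^ s| ≤ |a - b| ^ s := by
  have key : ∀ {a b : ℝ}, 0 ≤ a → 0 ≤ b → a ^ s ≤ b ^ s + |a - b| ^ s := by
    intro a b ha hb
    calc a ^ s ≤ (b + |a - b|) ^ s := Real.rpow_le_rpow ha (by linarith [le_abs_self (a - b)]) hs
      _ ≤ _ := Real.rpow_add_le_add_rpow hb (abs_nonneg _) hs hs1
  have h1 := key ha hb
  have h2 := key hb ha
  rw [abs_sub_comm b a] at h2
  rw [abs_le]; constructor <;> linarith

lemma rpow_le_one_add {a s : ℝ} (ha : 0 ≤ a) (hs : 0 ≤ s) (hs1 : s ≤ 1) : a ^ s ≤ 1 + a := by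
  calc a ^ s ≤ (1 + a) ^ s := Real.rpow_le_rpow ha (by linarith) hs
    _ ≤ (1 + a) ^ (1 : ℝ) := Real.rpow_le_rpow_of_exponent_le (by linarith) hs1
    _ = _ := Real.rpow_one _

lemma vC_sub (ζ κ : Z n) : vC (ζ - κ) = vC ζ - vC κ := by ext; simp [vC]
lemma xC_sub (ζ κ : Z n) : xC (ζ - κ) = xC ζ - xC κ := by ext; simp [xC]

lemma F_diff (hW : WH σ w) (ζ κ : Z n) :
    |Fsym σ w (vC ζ) - Fsym σ w (vC (ζ - κ))| ≤
      (10 * (1 + ‖κ‖) ^ 2) * (1 + ‖vC (ζ - κ)‖ ^ σ) := by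
  have h1 := abs_le.1 (Fsym_near hW.b hW.o hW.s0 hW.s1 (vC ζ))
  have h2 := abs_le.1 (Fsym_near hW.b hW.o hW.s0 hW.s1 (vC (ζ - κ)))
  have hσ := hW.s0
  set a := ‖vC ζ‖ with ha
  set b := ‖vC (ζ - κ)‖ with hb
  have ha0 : 0 ≤ a := norm_nonneg _
  have hb0 : 0 ≤ b := norm_nonneg _
  have hab : |a - b| ≤ ‖κ‖ := by
    refine (abs_norm_sub_norm_le _ _).trans ?_
    rw [vC_sub, sub_sub_cancel]; exact vC_le κ
  have e : ∀ x : ℝ, 0 ≤ x → x ^ (2 * σ) = x ^ σ * x ^ σ := fun x hx => by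
    rw [← sq, mul_comm, Real.rpow_mul hx, Real.rpow_two]
  have h3 : |a ^ σ - b ^ σ| ≤ 1 + ‖κ‖ :=
    (rpow_diff ha0 hb0 hσ.le hW.s1.le).trans
      ((Real.rpow_le_rpow (abs_nonneg _) hab hσ.le).trans
        (rpow_le_one_add (norm_nonneg _) hσ.le hW.s1.le))
  have hA : 0 ≤ a ^ σ := by positivity
  have hB : 0 ≤ b ^ σ := by positivity
  have h4 : |a ^ (2 * σ) - b ^ (2 * σ)| ≤ (1 + ‖κ‖) * (2 * b ^ σ + (1 + ‖κ‖)) := by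
    have e2 : a ^ (2 * σ) - b ^ (2 * σ) = (a ^ σ - b ^ σ) * (a ^ σ + b ^ σ) := by
      rw [e a ha0, e b hb0]; ring
    rw [e2, abs_mul, abs_of_nonneg (add_nonneg hA hB)]
    have := (abs_le.1 h3).2
    exact mul_le_mul h3 (by linarith) (add_nonneg hA hB) (by positivity)
  have hk := norm_nonneg κ
  have h5 : 8 + (1 + ‖κ‖) * (2 * b ^ σ + (1 + ‖κ‖)) ≤ (10 * (1 + ‖κ‖) ^ 2) * (1 + b ^ σ) := by
    have : 0 ≤ ‖κ‖ * b ^ σ := by positivity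
    have : 0 ≤ ‖κ‖ ^ 2 * b ^ σ := by positivity
    nlinarith
  refine le_trans ?_ h5
  have h6 := abs_le.1 h4
  rw [abs_le]; constructor <;> linarith [h1.1, h1.2, h2.1, h2.2, h6.1, h6.2]

lemma PGk : PG (fun κ : Z n => 10 * (1 + ‖κ‖) ^ 2) :=
  (PG.const 10).mul (((PG.const 1).add PG.norm).pow 2)

lemma PGv1 (hσ : 0 < σ) : PG (fun ζ : Z n => 1 + ‖vC ζ‖ ^ σ) :=
  (PG.const 1).add (PG.vn.rpow0 (fun _ => norm_nonneg _) hσ.le)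

open FourierTransform in
lemma int_shift (φ : SchwartzMap (Z n) ℂ) {q : Z n → ℂ} (hq : Integrable q) (ζ : Z n) :
    Integrable (fun κ => φ κ * q (ζ - κ)) := by
  refine (hq.comp_sub_left ζ).bdd_mul φ.continuous.aestronglyMeasurable (c := SchwartzMap.seminorm ℝ 0 0 φ)
    (Filter.Eventually.of_forall fun κ => SchwartzMap.norm_le_seminorm ℝ φ κ)

open FourierTransform in
/-- commutator estimate -/
lemma commL (hW : WH σ w) (φ : SchwartzMap (Z n) ℂ) : ∃ C : ℝ, 0 ≤ C ∧ ∀ u : SchwartzMap (Z n) ℂ,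
    L2 (fun z => fracLap σ w (mulS φ u) z - φ z * fracLap σ w u z) ∧
    nrm (fun z => fracLap σ w (mulS φ u) z - φ z * fracLap σ w u z) ≤
      C * nrm (fun ζ => ((1 + ‖vC ζ‖ ^ σ : ℝ) : ℂ) * 𝓕 u ζ) := by
  refine ⟨∫ κ, ‖((10 * (1 + ‖κ‖) ^ 2 : ℝ) : ℂ) * 𝓕 φ κ‖, integral_nonneg fun _ => norm_nonneg _,
    fun u => ?_⟩
  have hF := PGF hW
  set Q : Z n → ℂ := fun ζ => (Fsym σ w (vC ζ) : ℂ) * 𝓕 u ζ with hQ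
  have hQi : Integrable Q := hF.memL1 _
  set R1 : Z n → ℂ := fun ζ => (Fsym σ w (vC ζ) : ℂ) * 𝓕 (mulS φ u) ζ with hR1
  set R2 : Z n → ℂ := fun ζ => ∫ κ, 𝓕 φ κ * Q (ζ - κ) with hR2
  have i1 : Integrable R1 := hF.memL1 _
  have i2 : Integrable R2 := (𝓕 φ).integrable.integrable_convolution (ContinuousLinearMap.mul ℂ ℂ) hQi
  have e : (fun z => fracLap σ w (mulS φ u) z - φ z * fracLap σ w u z) =
      𝓕⁻ (fun ζ => R1 ζ - R2 ζ) := by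
    rw [finv_sub i1 i2, hR2, finv_conv (𝓕 φ).integrable hQi, ← SchwartzMap.fourierInv_coe,
      FourierTransform.fourierInv_fourier_eq, fracLap_S, fracLap_S]
  obtain ⟨y1, y2⟩ := young_nrm (R := fun ζ => R1 ζ - R2 ζ)
    (k := fun κ => ((10 * (1 + ‖κ‖) ^ 2 : ℝ) : ℂ) * 𝓕 φ κ)
    (g := fun ζ => ((1 + ‖vC ζ‖ ^ σ : ℝ) : ℂ) * 𝓕 u ζ)
    (r := fun ζ κ => 𝓕 φ κ * (((Fsym σ w (vC ζ) - Fsym σ w (vC (ζ - κ)) : ℝ) : ℂ) * 𝓕 u (ζ - κ)))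
    ((Complex.continuous_ofReal.comp PGk.1).mul (𝓕 φ).continuous) (PGk.memL1 _)
    ((Complex.continuous_ofReal.comp (PGv1 hW.s0).1).mul (𝓕 u).continuous)
    ((PGv1 hW.s0).memL2 _) (fun ζ => by
      simp only [hR1, hR2, fourier_mulS]
      rw [← integral_const_mul, ← integral_sub
        ((int_shift (𝓕 φ) (𝓕 u).integrable ζ).const_mul _) (int_shift (𝓕 φ) hQi ζ)]
      congr 1; ext κ
      simp only [hQ]; push_cast; ring)
    (fun ζ κ => by
      simp only [norm_mul, Complex.norm_real, Real.norm_eq_abs]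
      have h1 := F_diff hW ζ κ
      have h2 : 0 ≤ 1 + ‖vC (ζ - κ)‖ ^ σ := by positivity
      rw [abs_of_nonneg h2, abs_of_nonneg (by norm_num : (0 : ℝ) ≤ 10),
        abs_of_nonneg (by positivity : 0 ≤ (1 + ‖κ‖) ^ 2)]
      calc _ ≤ ‖𝓕 φ κ‖ * ((10 * (1 + ‖κ‖) ^ 2) * (1 + ‖vC (ζ - κ)‖ ^ σ) * ‖𝓕 u (ζ - κ)‖) := by gcongr
        _ = _ := by ring)
  have hL : L2 (fun ζ => R1 ζ - R2 ζ) := ⟨(i1.sub i2).1, y1⟩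
  rw [e]
  refine ⟨planchInv_memLp (i1.sub i2) hL, ?_⟩
  have e2 : nrm (𝓕⁻ fun ζ => R1 ζ - R2 ζ) = nrm (fun ζ => R1 ζ - R2 ζ) :=
    congrArg ENNReal.toReal (planchInv (i1.sub i2) hL)
  rw [e2]; exact y2

open FourierTransform in
lemma commD (hW : WH σ w) (φ : SchwartzMap (Z n) ℂ) (δ : ℝ) (hδ : 0 < δ) :
    ∃ C : ℝ, 0 ≤ C ∧ ∀ u : SchwartzMap (Z n) ℂ,
    L2 (fun z => fracLap σ w (mulS φ u) z - φ z * fracLap σ w u z) ∧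
    nrm (fun z => fracLap σ w (mulS φ u) z - φ z * fracLap σ w u z) ≤
      δ * nrm (fun ζ => (wG σ ζ : ℂ) * 𝓕 u ζ) + C * nrm u := by
  obtain ⟨C, hC, h⟩ := commL hW φ
  set ε := δ / (C + 1) with hε
  have hε0 : 0 < ε := by positivity
  refine ⟨C * (1 + 1 / ε), by positivity, fun u => ⟨(h u).1, (h u).2.trans ?_⟩⟩
  have hG : L2 (fun ζ => (wG σ ζ : ℂ) * 𝓕 u ζ) := PG.wG.memL2 _
  have hu : L2 (𝓕 u : SchwartzMap (Z n) ℂ) :=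
    (𝓕 u : SchwartzMap (Z n) ℂ).memLp 2
  have h1 : nrm (fun ζ => ((1 + ‖vC ζ‖ ^ σ : ℝ) : ℂ) * 𝓕 u ζ) ≤
      ε * nrm (fun ζ => (wG σ ζ : ℂ) * 𝓕 u ζ) + (1 + 1 / ε) * nrm u := by
    have e1 : nrm (fun ζ => (ε : ℂ) * ((wG σ ζ : ℂ) * 𝓕 u ζ)) ≤ ε * nrm (fun ζ => (wG σ ζ : ℂ) * 𝓕 u ζ) :=
      nrm_mono hG hε0.le fun ζ => by
        rw [norm_mul, Complex.norm_real, Real.norm_eq_abs, abs_of_pos hε0]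
    have e2 : nrm (fun ζ => ((1 + 1 / ε : ℝ) : ℂ) * 𝓕 u ζ) ≤ (1 + 1 / ε) * nrm u := by
      rw [← nrm_fourier u]
      refine nrm_mono hu (by positivity) fun ζ => ?_
      rw [norm_mul, Complex.norm_real, Real.norm_eq_abs, abs_of_pos (by positivity)]
    refine le_trans ?_ (add_le_add e1 e2)
    refine le_trans ?_ (nrm_add_le (hG.const_mul _) (hu.const_mul _))
    refine nrm_mono1 ((hG.const_mul _).add (hu.const_mul _)) fun ζ => ?_
    have e3 : (ε : ℂ) * ((wG σ ζ : ℂ) * 𝓕 u ζ) + ((1 + 1 / ε : ℝ) : ℂ) * 𝓕 u ζ =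
      ((ε * wG σ ζ + (1 + 1 / ε) : ℝ) : ℂ) * 𝓕 u ζ := by push_cast; ring
    have hGp := wG_ge hW.s0 ζ
    simp only [Pi.add_apply, e3]
    rw [norm_mul, norm_mul, Complex.norm_real, Complex.norm_real, Real.norm_eq_abs,
      Real.norm_eq_abs, abs_of_nonneg (by positivity), abs_of_nonneg (by positivity)]
    refine mul_le_mul_of_nonneg_right ?_ (norm_nonneg _)
    have h2 := vpow_le hW.s0 ζ
    rw [mul_comm 2 σ, Real.rpow_mul (norm_nonneg _), Real.rpow_two] at h2
    set y := ‖vC ζ‖ ^ σ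
    have h3 : y ≤ ε * y ^ 2 + 1 / ε := by
      have : 0 ≤ (ε * y - 1) ^ 2 + ε * y + 0 := by positivity
      have h4 : ε * y ≤ ε * (ε * y ^ 2 + 1 / ε) := by
        rw [mul_add, mul_one_div_cancel hε0.ne']; nlinarith [sq_nonneg (ε * y - 1)]
      exact le_of_mul_le_mul_left h4 hε0
    have h5 := mul_le_mul_of_nonneg_left h2 hε0.le
    linarith
  have h6 : C * ε ≤ δ := by
    rw [hε, ← mul_div_assoc, div_le_iff₀ (by positivity)]; nlinarith
  have h7 := nrm_nonneg (fun ζ => (wG σ ζ : ℂ) * 𝓕 u ζ)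
  calc _ ≤ C * (ε * nrm (fun ζ => (wG σ ζ : ℂ) * 𝓕 u ζ) + (1 + 1 / ε) * nrm u) := by gcongr
    _ = (C * ε) * nrm (fun ζ => (wG σ ζ : ℂ) * 𝓕 u ζ) + C * (1 + 1 / ε) * nrm u := by ring
    _ ≤ _ := by gcongr

end PartG

section PartH

variable {σ : ℝ} {w : E n → ℝ}

lemma X0_mulS (φ u : SchwartzMap (Z n) ℂ) (z : Z n) :
    X0 (mulS φ u) z = φ z * X0 u z + X0 φ z * u z := by
  have e : (mulS φ u : Z n → ℂ) = fun z => φ z * u z := rfl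
  have h : ∀ m, fderiv ℝ (mulS φ u) z m = φ z * fderiv ℝ u z m + fderiv ℝ φ z m * u z := by
    intro m
    rw [e, fderiv_fun_mul φ.differentiableAt u.differentiableAt]
    simp [mul_comm]
  simp only [X0_apply, h, mul_add, add_mul, Finset.mul_sum, Finset.sum_mul, Finset.sum_add_distrib]
  rw [Finset.sum_congr rfl (fun i _ => by ring : ∀ i ∈ Finset.univ,
    (vC z i : ℂ) * (φ z * fderiv ℝ u z (eX i)) = φ z * ((vC z i : ℂ) * fderiv ℝ u z (eX i))),
    Finset.sum_congr rfl (fun i _ => by ring : ∀ i ∈ Finset.univ,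
    (vC z i : ℂ) * (fderiv ℝ φ z (eX i) * u z) = (vC z i : ℂ) * fderiv ℝ φ z (eX i) * u z)]
  ring

lemma Pop_apply (a : Z n → ℝ) (u : SchwartzMap (Z n) ℂ) (z : Z n) :
    Pop σ w a u z = X0 u z + (a z : ℂ) * fracLap σ w u z := by
  rw [X0_apply]; rfl

lemma aL_L2 (hW : WH σ w) {a : Z n → ℝ} (ha : Continuous a) {B : ℝ} (hB : ∀ z, |a z| ≤ B)
    (u : SchwartzMap (Z n) ℂ) : L2 (fun z => (a z : ℂ) * fracLap σ w u z) := by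
  have h := fracLap_L2 hW u
  refine MemLp.of_le_mul (c := B) h
    ((Complex.continuous_ofReal.comp ha).aestronglyMeasurable.mul h.1)
    (Filter.Eventually.of_forall fun z => ?_)
  rw [norm_mul, Complex.norm_real]
  exact mul_le_mul_of_nonneg_right (hB z) (norm_nonneg _)

lemma Pop_L2 (hW : WH σ w) {a : Z n → ℝ} (ha : Continuous a) {B : ℝ} (hB : ∀ z, |a z| ≤ B)
    (u : SchwartzMap (Z n) ℂ) : L2 (Pop σ w a u) := by
  have e : Pop σ w a u = fun z => X0 u z + (a z : ℂ) * fracLap σ w u z := funext (Pop_apply a u)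
  rw [e]
  exact ((X0 u).memLp 2).add (aL_L2 hW ha hB u)

open FourierTransform in
lemma Lam_le (hW : WH σ w) (u : SchwartzMap (Z n) ℂ) :
    nrm (fracLap σ w u) ≤ 5 * nrm (fun ζ => (wG σ ζ : ℂ) * 𝓕 u ζ) := by
  rw [nrm_fracLap hW]
  refine nrm_mono (PG.wG.memL2 _) (by norm_num) fun ζ => ?_
  rw [nrm_ofR (wG_ge hW.s0 ζ), norm_mul, Complex.norm_real, Real.norm_eq_abs,
    abs_of_nonneg (Fsym_nonneg hW.b _), ← mul_assoc]
  refine mul_le_mul_of_nonneg_right ?_ (norm_nonneg _)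
  have := (abs_le.1 (Fsym_near hW.b hW.o hW.s0 hW.s1 (vC ζ))).2
  linarith [vpow_le hW.s0 ζ, wG_ge hW.s0 ζ]

lemma arith_piece {C₁ ε b G N P U B δ' C' Gu X M : ℝ} (hC₁ : 0 ≤ C₁) (hε : 0 ≤ ε) (hb : 0 ≤ b)
    (hG : 0 ≤ G) (h : G ≤ C₁ * (X + U)) (hX : X ≤ P + B * U + b * N + ε * M) (hM : M ≤ 5 * G + N)
    (hN : N ≤ δ' * Gu + C' * U) (hs : 10 * C₁ * ε ≤ 1) :
    G ≤ 2 * C₁ * (P + (B + 1) * U + (b + ε) * (δ' * Gu + C' * U)) := by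
  have h1 : ε * M ≤ ε * (5 * G + N) := by gcongr
  have h2 : (b + ε) * N ≤ (b + ε) * (δ' * Gu + C' * U) := by gcongr
  have h3 : X + U ≤ (P + (B + 1) * U + (b + ε) * (δ' * Gu + C' * U)) + 5 * ε * G := by linarith
  have h4 := h.trans (mul_le_mul_of_nonneg_left h3 hC₁)
  have h5 : C₁ * (5 * ε * G) ≤ G / 2 := by
    have := mul_le_mul_of_nonneg_right hs hG
    linarith
  linarith

open FourierTransform in
lemma piece (hW : WH σ w) {a : Z n → ℝ} (ha : Continuous a) {B : ℝ} (hB : ∀ z, |a z| ≤ B)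
    {a₀ : ℝ} (ha₀ : 0 < a₀) (φ : SchwartzMap (Z n) ℂ) (hφ : ∀ z, ‖φ z‖ ≤ 1) {b ε : ℝ} (hb : a₀ ≤ b)
    (hε : 0 ≤ ε) (hs : 10 * (100 * (1 + 1 / a₀) ^ 2) * ε ≤ 1)
    (hφa : ∀ z, φ z ≠ 0 → |b - a z| ≤ ε) (δ : ℝ) (hδ : 0 < δ) :
    ∃ D : ℝ, 0 ≤ D ∧ ∀ u : SchwartzMap (Z n) ℂ,
      nrm (fun ζ => (wG σ ζ : ℂ) * 𝓕 (mulS φ u) ζ) ≤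
        D * (nrm (Pop σ w a u) + nrm u) + δ * nrm (fun ζ => (wG σ ζ : ℂ) * 𝓕 u ζ) := by
  set C₁ := 100 * (1 + 1 / a₀) ^ 2 with hC₁
  have hC₁0 : 0 < C₁ := by positivity
  have hb0 : 0 < b := by linarith
  have hbe : 0 < b + ε := by linarith
  obtain ⟨C', hC', hcomm⟩ := commD hW φ (δ / (2 * C₁ * (b + ε))) (by positivity)
  set δ' := δ / (2 * C₁ * (b + ε)) with hδ'
  set Bφ := SchwartzMap.seminorm ℝ 0 0 (X0 φ) with hBφ
  have hBφ0 : 0 ≤ Bφ := apply_nonneg _ _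
  refine ⟨2 * C₁ * (1 + (Bφ + 1) + (b + ε) * C'), by positivity, fun u => ?_⟩
  obtain ⟨cL, cN⟩ := hcomm u
  set c : Z n → ℂ := fun z => fracLap σ w (mulS φ u) z - φ z * fracLap σ w u z with hc
  have hP := Pop_L2 hW ha hB u
  have hu : L2 u := u.memLp 2
  have hΛ := fracLap_L2 hW u
  have hφm := φ.continuous.aestronglyMeasurable (μ := volume)
  have l1 : L2 (fun z => φ z * Pop σ w a u z) :=
    MemLp.of_le hP (hφm.mul hP.1) (Filter.Eventually.of_forall fun z => by
      rw [norm_mul]; exact mul_le_of_le_one_left (norm_nonneg _) (hφ z))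
  have n1 : nrm (fun z => φ z * Pop σ w a u z) ≤ nrm (Pop σ w a u) := nrm_mono1 hP fun z => by
    rw [norm_mul]; exact mul_le_of_le_one_left (norm_nonneg _) (hφ z)
  have l2 : L2 (fun z => X0 φ z * u z) := by
    have h : L2 (mulS (X0 φ) u : Z n → ℂ) := (mulS (X0 φ) u).memLp 2
    exact h
  have n2 : nrm (fun z => X0 φ z * u z) ≤ Bφ * nrm u := nrm_mono hu hBφ0 fun z => by
    rw [norm_mul]
    exact mul_le_mul_of_nonneg_right (SchwartzMap.norm_le_seminorm ℝ _ z) (norm_nonneg _)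
  have l3 : L2 (fun z => (b : ℂ) * c z) := cL.const_mul _
  have n3 : nrm (fun z => (b : ℂ) * c z) ≤ b * nrm c := nrm_mono cL hb0.le fun z => by
    rw [norm_mul, Complex.norm_real, Real.norm_eq_abs, abs_of_pos hb0]
  have l5 : L2 (fun z => φ z * fracLap σ w u z) :=
    MemLp.of_le hΛ (hφm.mul hΛ.1) (Filter.Eventually.of_forall fun z => by
      rw [norm_mul]; exact mul_le_of_le_one_left (norm_nonneg _) (hφ z))
  have p4 : ∀ z, ‖((b - a z : ℝ) : ℂ) * (φ z * fracLap σ w u z)‖ ≤ ε * ‖φ z * fracLap σ w u z‖ := by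
    intro z
    by_cases h0 : φ z = 0
    · simp [h0]
    · rw [norm_mul, Complex.norm_real]
      exact mul_le_mul_of_nonneg_right (hφa z h0) (norm_nonneg _)
  have l4 : L2 (fun z => ((b - a z : ℝ) : ℂ) * (φ z * fracLap σ w u z)) :=
    MemLp.of_le_mul l5 ((Complex.continuous_ofReal.comp
      (continuous_const.sub ha)).aestronglyMeasurable.mul l5.1) (Filter.Eventually.of_forall p4)
  have n4 := nrm_mono l5 hε p4
  have n5 : nrm (fun z => φ z * fracLap σ w u z) ≤
      5 * nrm (fun ζ => (wG σ ζ : ℂ) * 𝓕 (mulS φ u) ζ) + nrm c := by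
    have e : (fun z => φ z * fracLap σ w u z) = fun z => fracLap σ w (mulS φ u) z - c z := by
      ext z; simp [hc]
    rw [e]
    exact (nrm_sub_le (fracLap_L2 hW _) cL).trans (add_le_add_left (Lam_le hW _) _)
  have n6 : nrm (mulS φ u) ≤ nrm u := nrm_mono1 hu fun z => by
    rw [mulS_apply, norm_mul]; exact mul_le_of_le_one_left (norm_nonneg _) (hφ z)
  have hmain := const_phys hW ha₀ hb (mulS φ u)
  have nX : nrm (fun z => X0 (mulS φ u) z + (b : ℂ) * fracLap σ w (mulS φ u) z) ≤
      nrm (Pop σ w a u) + Bφ * nrm u + b * nrm c + ε * nrm (fun z => φ z * fracLap σ w u z) := by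
    have e : (fun z => X0 (mulS φ u) z + (b : ℂ) * fracLap σ w (mulS φ u) z) =
        fun z => (((φ z * Pop σ w a u z) + X0 φ z * u z) + (b : ℂ) * c z)
          + ((b - a z : ℝ) : ℂ) * (φ z * fracLap σ w u z) := by
      ext z
      rw [X0_mulS, Pop_apply]
      simp only [hc]; push_cast; ring
    rw [e]
    refine (nrm_add_le ((l1.add l2).add l3) l4).trans (add_le_add ?_ n4)
    refine (nrm_add_le (l1.add l2) l3).trans (add_le_add ?_ n3)
    exact (nrm_add_le l1 l2).trans (add_le_add n1 n2)
  have := arith_piece hC₁0.le hε hb0.le (nrm_nonneg _)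
    (hmain.trans (mul_le_mul_of_nonneg_left (add_le_add_right n6 _) hC₁0.le)) nX n5 cN hs
  refine this.trans ?_
  have e1 : 2 * C₁ * ((b + ε) * δ') = δ := by
    rw [hδ']; field_simp
  have hp := nrm_nonneg (Pop σ w a u)
  have hu0 := nrm_nonneg u
  have e2 : 2 * C₁ * (nrm (Pop σ w a u) + (Bφ + 1) * nrm u +
      (b + ε) * (δ' * nrm (fun ζ => (wG σ ζ : ℂ) * 𝓕 u ζ) + C' * nrm u)) =
      2 * C₁ * (nrm (Pop σ w a u) + (Bφ + 1) * nrm u + (b + ε) * C' * nrm u)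
      + (2 * C₁ * ((b + ε) * δ')) * nrm (fun ζ => (wG σ ζ : ℂ) * 𝓕 u ζ) := by ring
  rw [e2, e1]
  have h9 : 0 ≤ (Bφ + 1 + (b + ε) * C') * nrm (Pop σ w a u) := by positivity
  have h10 : nrm (Pop σ w a u) + (Bφ + 1) * nrm u + (b + ε) * C' * nrm u ≤
    (1 + (Bφ + 1) + (b + ε) * C') * (nrm (Pop σ w a u) + nrm u) := by nlinarith
  have h11 := mul_le_mul_of_nonneg_left h10 (by positivity : 0 ≤ 2 * C₁)
  linarith

open scoped Manifold ContDiff in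
lemma partition {a : Z n → ℝ} (ha : Continuous a) {ε : ℝ} (hε : 0 < ε) {K : Set (Z n)}
    (hK : IsCompact K) : ∃ (s : Finset (Z n)) (φ : s → SchwartzMap (Z n) ℂ),
      (∀ i z, ‖φ i z‖ ≤ 1) ∧ (∀ i z, φ i z ≠ 0 → |a i - a z| ≤ ε) ∧ ∀ z ∈ K, ∑ i, φ i z = 1 := by
  set U : Z n → Set (Z n) := fun x => {y | |a x - a y| < ε} ∩ Metric.ball x 1 with hU
  have hUo : ∀ x, IsOpen (U x) := fun x =>
    (isOpen_lt ((continuous_const.sub ha).abs) continuous_const).inter Metric.isOpen_ball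
  obtain ⟨s, hs⟩ := hK.elim_finite_subcover U hUo (fun x _ => Set.mem_iUnion.2 ⟨x, by simp [hU, hε]⟩)
  obtain ⟨f, hf⟩ := SmoothPartitionOfUnity.exists_isSubordinate 𝓘(ℝ, Z n) hK.isClosed
    (fun i : s => U i) (fun i => hUo i) (by
      intro x hx
      obtain ⟨i, hi, hxi⟩ := Set.mem_iUnion₂.1 (hs hx)
      exact Set.mem_iUnion.2 ⟨⟨i, hi⟩, hxi⟩)
  have hcs : ∀ i, HasCompactSupport (fun z => (f i z : ℂ)) := by
    intro i
    have h1 : HasCompactSupport (f i) := by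
      refine (isCompact_closedBall (i : Z n) 1).of_isClosed_subset (isClosed_tsupport _) ?_
      exact (hf i).trans (Set.inter_subset_right.trans Metric.ball_subset_closedBall)
    exact h1.comp_left (g := fun x : ℝ => (x : ℂ)) (by simp)
  have hsm : ∀ i, ContDiff ℝ ∞ (fun z => (f i z : ℂ)) := fun i =>
    Complex.ofRealCLM.contDiff.comp (f i).contMDiff.contDiff
  refine ⟨s, fun i => (hcs i).toSchwartzMap (hsm i), fun i z => ?_, fun i z h => ?_, fun z hz => ?_⟩
  · change ‖(f i z : ℂ)‖ ≤ 1
    rw [Complex.norm_real, Real.norm_eq_abs, abs_of_nonneg (f.nonneg i z)]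
    exact f.le_one i z
  · have h1 : f i z ≠ 0 := by
      intro h0; exact h (by change (f i z : ℂ) = 0; simp [h0])
    exact (hf i (subset_tsupport _ h1)).1.le
  · have := f.sum_eq_one hz
    rw [finsum_eq_sum_of_fintype] at this
    change ∑ i, (f i z : ℂ) = 1
    rw [← Complex.ofReal_sum, this]; simp

open FourierTransform in
lemma main_G (hW : WH σ w) {a : Z n → ℝ} (ha : Continuous a) {B : ℝ} (hB : ∀ z, |a z| ≤ B)
    {a₀ : ℝ} (ha₀ : 0 < a₀) (hLB : ∀ z, a₀ ≤ a z) {K : Set (Z n)} (hK : IsCompact K) :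
    ∃ D : ℝ, 0 ≤ D ∧ ∀ u : SchwartzMap (Z n) ℂ, tsupport u ⊆ K →
      nrm (fun ζ => (wG σ ζ : ℂ) * 𝓕 u ζ) ≤ D * (nrm (Pop σ w a u) + nrm u) := by
  set ε := 1 / (10 * (100 * (1 + 1 / a₀) ^ 2)) with hε
  have hε0 : 0 < ε := by positivity
  obtain ⟨s, φ, h1, h2, h3⟩ := partition ha hε0 hK
  set δ := 1 / (2 * ((Fintype.card s : ℝ) + 1)) with hδ
  have hδ0 : 0 < δ := by positivity
  have hp := fun i => piece hW ha hB ha₀ (φ i) (h1 i) (hLB i) hε0.le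
    (by rw [hε, mul_one_div_cancel (by positivity)]) (h2 i) δ hδ0
  choose D hD0 hD using hp
  refine ⟨2 * ∑ i, D i, by have := Finset.sum_nonneg (fun i (_ : i ∈ Finset.univ) => hD0 i); positivity,
    fun u hu => ?_⟩
  have e : u = ∑ i, mulS (φ i) u := by
    ext z
    rw [sum_apply]
    simp only [mulS_apply]
    rw [← Finset.sum_mul]
    by_cases hz : z ∈ K
    · rw [h3 z hz, one_mul]
    · rw [image_eq_zero_of_notMem_tsupport (fun h => hz (hu h)), mul_zero]
  have e2 : (fun ζ => (wG σ ζ : ℂ) * 𝓕 u ζ) =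
      fun ζ => ∑ i, (wG σ ζ : ℂ) * 𝓕 (mulS (φ i) u) ζ := by
    ext ζ
    conv_lhs => rw [e, FourierTransform.fourier_sum, sum_apply, Finset.mul_sum]
  set G := nrm (fun ζ => (wG σ ζ : ℂ) * 𝓕 u ζ) with hG
  set T := nrm (Pop σ w a u) + nrm u with hT
  have hG0 : 0 ≤ G := nrm_nonneg _
  have h4 : G ≤ ∑ i, (D i * T + δ * G) := by
    conv_lhs => rw [hG, e2]
    exact (nrm_sum_le Finset.univ (fun i => PG.wG.memL2 _)).trans
      (Finset.sum_le_sum fun i _ => hD i u)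
  rw [Finset.sum_add_distrib, ← Finset.sum_mul, Finset.sum_const, Finset.card_univ, nsmul_eq_mul] at h4
  have h5 : (Fintype.card s : ℝ) * δ ≤ 1 / 2 := by
    rw [hδ, mul_one_div, div_le_div_iff₀ (by positivity) (by norm_num)]; linarith
  have h6 := mul_le_mul_of_nonneg_right h5 hG0
  linarith

end PartH

section PartI

/-- pointwise absolute value, as a complex function -/
def absF (f : Z n → ℂ) : Z n → ℂ := fun z => ((‖f z‖ : ℝ) : ℂ)

lemma absF_L2 {f : Z n → ℂ} (hf : L2 f) : L2 (absF f) := hf.norm.ofReal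

lemma absF_norm (f : Z n → ℂ) (z : Z n) : ‖absF f z‖ = ‖f z‖ := by
  simp [absF]

lemma nrm_absF (f : Z n → ℂ) : nrm (absF f) = nrm f :=
  congrArg ENNReal.toReal (eLpNorm_congr_norm_ae (Filter.Eventually.of_forall (absF_norm f)))

lemma PGx1 {s : ℝ} (hs : 0 ≤ s) : PG (fun ζ : Z n => 1 + ‖xC ζ‖ ^ s) :=
  (PG.const 1).add (PG.xn.rpow0 (fun _ => norm_nonneg _) hs)

lemma PGk1 : PG (fun κ : Z n => 1 + ‖κ‖) := (PG.const 1).add PG.norm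

lemma xpow_diff {s : ℝ} (hs : 0 ≤ s) (hs1 : s ≤ 1) (ζ κ : Z n) :
    ‖xC ζ‖ ^ s ≤ (1 + ‖κ‖) * (1 + ‖xC (ζ - κ)‖ ^ s) := by
  have h1 := rpow_diff (norm_nonneg (xC ζ)) (norm_nonneg (xC (ζ - κ))) hs hs1
  have h2 : |‖xC ζ‖ - ‖xC (ζ - κ)‖| ≤ ‖κ‖ := by
    refine (abs_norm_sub_norm_le _ _).trans ?_
    rw [xC_sub, sub_sub_cancel]
    exact xC_le κ
  have h3 := rpow_le_one_add (abs_nonneg (‖xC ζ‖ - ‖xC (ζ - κ)‖)) hs hs1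
  have h4 := (le_abs_self _).trans h1
  have h5 : 0 ≤ ‖κ‖ * ‖xC (ζ - κ)‖ ^ s := by positivity
  nlinarith

open FourierTransform in
lemma xpow_mul {s : ℝ} (hs : 0 ≤ s) (hs1 : s ≤ 1) (φ : SchwartzMap (Z n) ℂ) :
    ∃ C : ℝ, 0 ≤ C ∧ ∀ u : SchwartzMap (Z n) ℂ,
      nrm (fun ζ => ((‖xC ζ‖ ^ s : ℝ) : ℂ) * 𝓕 (mulS φ u) ζ) ≤
        C * nrm (fun ζ => ((1 + ‖xC ζ‖ ^ s : ℝ) : ℂ) * 𝓕 u ζ) := by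
  refine ⟨∫ κ, ‖((1 + ‖κ‖ : ℝ) : ℂ) * 𝓕 φ κ‖, integral_nonneg fun _ => norm_nonneg _, fun u => ?_⟩
  refine (young_nrm (k := fun κ => ((1 + ‖κ‖ : ℝ) : ℂ) * 𝓕 φ κ)
    (g := fun ζ => ((1 + ‖xC ζ‖ ^ s : ℝ) : ℂ) * 𝓕 u ζ)
    (r := fun ζ κ => ((‖xC ζ‖ ^ s : ℝ) : ℂ) * (𝓕 φ κ * 𝓕 u (ζ - κ)))
    ((Complex.continuous_ofReal.comp PGk1.1).mul (𝓕 φ).continuous) (PGk1.memL1 _)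
    ((Complex.continuous_ofReal.comp (PGx1 hs).1).mul (𝓕 u).continuous)
    ((PGx1 hs).memL2 _) (fun ζ => by
      simp only [fourier_mulS]
      rw [← integral_const_mul])
    (fun ζ κ => by
      simp only [norm_mul, Complex.norm_real, Real.norm_eq_abs]
      have h2 : 0 ≤ 1 + ‖xC (ζ - κ)‖ ^ s := by positivity
      have h3 : 0 ≤ ‖xC ζ‖ ^ s := by positivity
      have h4 : 0 ≤ 1 + ‖κ‖ := by positivity
      rw [abs_of_nonneg h2, abs_of_nonneg h3, abs_of_nonneg h4]
      calc _ ≤ ((1 + ‖κ‖) * (1 + ‖xC (ζ - κ)‖ ^ s)) * (‖𝓕 φ κ‖ * ‖𝓕 u (ζ - κ)‖) :=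
            mul_le_mul_of_nonneg_right (xpow_diff hs hs1 ζ κ) (by positivity)
        _ = _ := by ring)).2

lemma tau_real {t x s A Y S : ℝ} (ht : 0 ≤ t) (hx : 0 ≤ x) (hs : 0 ≤ s) (hs1 : s ≤ 1)
    (hA : 0 ≤ A) (hY : 0 ≤ Y) (hS : 0 ≤ S) (h : t * A ≤ Y + x * S) :
    t ^ s * A ≤ (1 + x ^ s) * A + Y + x ^ s * S := by
  have hxs : 0 ≤ x ^ s := by positivity
  have hr : 0 ≤ x ^ s * S := by positivity
  by_cases h1 : t ≤ 1
  · have := mul_le_mul_of_nonneg_right (Real.rpow_le_one ht h1 hs) hA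
    have h3 : 0 ≤ x ^ s * A := by positivity
    linarith
  by_cases h2 : t ≤ x
  · have := mul_le_mul_of_nonneg_right (Real.rpow_le_rpow ht h2 hs) hA
    linarith
  push Not at h1 h2
  have ht0 : 0 < t := by linarith
  have e1 : t ^ s ≤ t := by
    simpa using Real.rpow_le_rpow_of_exponent_le h1.le hs1
  have e2 : x * t ^ s ≤ t * x ^ s := by
    have hx1 : x = x ^ (1 - s) * x ^ s := by
      rw [← Real.rpow_add_of_nonneg hx (by linarith) hs]; simp
    have ht1 : t = t ^ (1 - s) * t ^ s := by
      rw [← Real.rpow_add_of_nonneg ht (by linarith) hs]; simp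
    have h3 : x ^ (1 - s) ≤ t ^ (1 - s) := Real.rpow_le_rpow hx h2.le (by linarith)
    calc x * t ^ s = x ^ (1 - s) * (x ^ s * t ^ s) := by rw [← mul_assoc, ← hx1]
      _ ≤ t ^ (1 - s) * (x ^ s * t ^ s) := mul_le_mul_of_nonneg_right h3 (by positivity)
      _ = (t ^ (1 - s) * t ^ s) * x ^ s := by ring
      _ = t * x ^ s := by rw [← ht1]
  have e3 : t * (t ^ s * A) ≤ t * (Y + x ^ s * S) := by
    calc t * (t ^ s * A) = t ^ s * (t * A) := by ring
      _ ≤ t ^ s * (Y + x * S) := mul_le_mul_of_nonneg_left h (by positivity)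
      _ = t ^ s * Y + (x * t ^ s) * S := by ring
      _ ≤ t * Y + (t * x ^ s) * S := by gcongr
      _ = _ := by ring
  have e4 := le_of_mul_le_mul_left e3 ht0
  have h3 : 0 ≤ (1 + x ^ s) * A := by positivity
  linarith

/-- multiplication by the velocity coordinate -/
def vS (j : Fin n) (u : SchwartzMap (Z n) ℂ) : SchwartzMap (Z n) ℂ :=
  SchwartzMap.smulLeftCLM ℂ (fun z : Z n => inner ℝ z (eV j)) u

open FourierTransform in
lemma X0_fourier2 (u : SchwartzMap (Z n) ℂ) (ζ : Z n) :
    𝓕 (X0 u) ζ = 2 * π * Complex.I * (tC ζ : ℂ) * 𝓕 u ζ +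
      ∑ j : Fin n, 2 * π * Complex.I * (xC ζ j : ℂ) * 𝓕 (vS j u) ζ := by
  unfold X0
  rw [FourierTransform.fourier_add, SchwartzMap.fourier_lineDerivOp_eq, FourierTransform.fourier_sum,
    add_apply, sum_apply]
  congr 1
  · rw [smul_apply, SchwartzMap.smulLeftCLM_apply_apply (tg _), inner_eT]
    simp [mul_assoc]
  · refine Finset.sum_congr rfl fun j _ => ?_
    rw [SchwartzMap.fourier_lineDerivOp_eq, smul_apply,
      SchwartzMap.smulLeftCLM_apply_apply (tg _), inner_eX]
    simp [mul_assoc, vS]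

open FourierTransform in
lemma tau_point {s : ℝ} (hs : 0 ≤ s) (hs1 : s ≤ 1) (u : SchwartzMap (Z n) ℂ) (ζ : Z n) :
    |tC ζ| ^ s * ‖𝓕 u ζ‖ ≤ (1 + ‖xC ζ‖ ^ s) * ‖𝓕 u ζ‖ + ‖𝓕 (X0 u) ζ‖ +
      ∑ j : Fin n, ‖xC ζ‖ ^ s * ‖𝓕 (vS j u) ζ‖ := by
  rw [← Finset.mul_sum]
  refine tau_real (abs_nonneg _) (norm_nonneg _) hs hs1 (norm_nonneg _) (norm_nonneg _)
    (Finset.sum_nonneg fun _ _ => norm_nonneg _) ?_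
  have h := X0_fourier2 u ζ
  have h1 : 2 * π * Complex.I * (tC ζ : ℂ) * 𝓕 u ζ = 𝓕 (X0 u) ζ -
      ∑ j : Fin n, 2 * π * Complex.I * (xC ζ j : ℂ) * 𝓕 (vS j u) ζ := by rw [h]; ring
  have h2 : ‖2 * π * Complex.I * (tC ζ : ℂ) * 𝓕 u ζ‖ = 2 * π * (|tC ζ| * ‖𝓕 u ζ‖) := by
    simp [abs_of_pos Real.pi_pos, mul_assoc]
  have h3 : ‖∑ j : Fin n, 2 * π * Complex.I * (xC ζ j : ℂ) * 𝓕 (vS j u) ζ‖ ≤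
      2 * π * (‖xC ζ‖ * ∑ j : Fin n, ‖𝓕 (vS j u) ζ‖) := by
    rw [Finset.mul_sum, Finset.mul_sum]
    refine (norm_sum_le _ _).trans (Finset.sum_le_sum fun j _ => ?_)
    have h4 : |xC ζ j| ≤ ‖xC ζ‖ := PiLp.norm_apply_le (xC ζ) j
    have : ‖2 * π * Complex.I * (xC ζ j : ℂ) * 𝓕 (vS j u) ζ‖ =
      2 * π * (|xC ζ j| * ‖𝓕 (vS j u) ζ‖) := by
      simp [abs_of_pos Real.pi_pos, mul_assoc]
    rw [this]
    have := Real.pi_pos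
    gcongr
  have h5 := norm_sub_le (𝓕 (X0 u) ζ) (∑ j : Fin n, 2 * π * Complex.I * (xC ζ j : ℂ) * 𝓕 (vS j u) ζ)
  rw [← h1, h2] at h5
  have hp : 1 ≤ 2 * π := by have := Real.pi_gt_three; linarith
  have h6 : ‖𝓕 (X0 u) ζ‖ ≤ 2 * π * ‖𝓕 (X0 u) ζ‖ := le_mul_of_one_le_left (norm_nonneg _) hp
  refine le_of_mul_le_mul_left (a := 2 * π) ?_ (by linarith)
  rw [mul_add]
  linarith

open FourierTransform in
lemma tau_L2 {s : ℝ} (hs : 0 ≤ s) (u : SchwartzMap (Z n) ℂ) :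
    L2 (fun ζ => ((|tC ζ| ^ s : ℝ) : ℂ) * 𝓕 u ζ) := by
  refine PG.memL2 (PG.rpow0 (PG.of_le tC_cont.abs PG.norm fun ζ => ?_) (fun _ => abs_nonneg _) hs) _
  rw [abs_abs]; exact tC_le ζ

open FourierTransform in
lemma tau_nrm {s : ℝ} (hs : 0 ≤ s) (hs1 : s ≤ 1) {K : Set (Z n)} (hK : IsCompact K) :
    ∃ C : ℝ, 0 ≤ C ∧ ∀ u : SchwartzMap (Z n) ℂ, tsupport u ⊆ K →
      nrm (fun ζ => ((|tC ζ| ^ s : ℝ) : ℂ) * 𝓕 u ζ) ≤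
        C * nrm (fun ζ => ((1 + ‖xC ζ‖ ^ s : ℝ) : ℂ) * 𝓕 u ζ) + nrm (X0 u) := by
  obtain ⟨t, φ, -, -, hφ⟩ := partition (a := fun _ : Z n => 0) continuous_const one_pos hK
  set χ : SchwartzMap (Z n) ℂ := ∑ i, φ i with hχ
  have hχ1 : ∀ z ∈ K, χ z = 1 := fun z hz => by rw [hχ, sum_apply]; exact hφ z hz
  choose C hC0 hC using fun j : Fin n => xpow_mul hs hs1 (vS j χ)
  refine ⟨1 + ∑ j, C j, by have := Finset.sum_nonneg fun j (_ : j ∈ Finset.univ) => hC0 j; linarith,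
    fun u hu => ?_⟩
  have hv : ∀ j, vS j u = mulS (vS j χ) u := by
    intro j
    ext z
    rw [mulS_apply, vS, vS, SchwartzMap.smulLeftCLM_apply_apply (tg _),
      SchwartzMap.smulLeftCLM_apply_apply (tg _)]
    by_cases hz : z ∈ K
    · rw [hχ1 z hz]; simp
    · have : u z = 0 := image_eq_zero_of_notMem_tsupport fun h => hz (hu h)
      simp [this]
  set f1 : Z n → ℂ := fun ζ => ((1 + ‖xC ζ‖ ^ s : ℝ) : ℂ) * 𝓕 u ζ with hf1
  set f2 : Z n → ℂ := ⇑(𝓕 (X0 u) : SchwartzMap (Z n) ℂ) with hf2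
  set f3 : Fin n → Z n → ℂ := fun j ζ => ((‖xC ζ‖ ^ s : ℝ) : ℂ) * 𝓕 (vS j u) ζ with hf3
  have l1 : L2 f1 := (PGx1 hs).memL2 _
  have l2 : L2 f2 := (𝓕 (X0 u)).memLp 2
  have l3 : ∀ j, L2 (f3 j) := fun j => (PG.xn.rpow0 (fun _ => norm_nonneg _) hs).memL2 _
  have l4 : L2 (fun ζ => ∑ j, absF (f3 j) ζ) := by
    exact memLp_finset_sum _ fun j _ => absF_L2 (l3 j)
  have n4 : nrm (fun ζ => ∑ j, absF (f3 j) ζ) ≤ (∑ j, C j) * nrm f1 := by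
    refine (nrm_sum_le _ fun j => absF_L2 (l3 j)).trans ?_
    rw [Finset.sum_mul]
    refine Finset.sum_le_sum fun j _ => ?_
    rw [nrm_absF]
    simp only [hf3]
    rw [hv j]
    exact hC j u
  have l5 : L2 (fun ζ => absF f1 ζ + absF f2 ζ) := (absF_L2 l1).add (absF_L2 l2)
  have l6 : L2 (fun ζ => (absF f1 ζ + absF f2 ζ) + ∑ j, absF (f3 j) ζ) := l5.add l4
  have n1 : nrm (fun ζ => ((|tC ζ| ^ s : ℝ) : ℂ) * 𝓕 u ζ) ≤
      nrm (fun ζ => (absF f1 ζ + absF f2 ζ) + ∑ j, absF (f3 j) ζ) := by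
    refine nrm_mono1 l6 fun ζ => ?_
    have h := tau_point hs hs1 u ζ
    have hx : 0 ≤ ‖xC ζ‖ ^ s := by positivity
    have e1 : ‖f1 ζ‖ = (1 + ‖xC ζ‖ ^ s) * ‖𝓕 u ζ‖ := by
      rw [hf1]; simp only [norm_mul, Complex.norm_real, Real.norm_eq_abs]
      rw [abs_of_nonneg (by positivity)]
    have e3 : ∀ j, ‖f3 j ζ‖ = ‖xC ζ‖ ^ s * ‖𝓕 (vS j u) ζ‖ := fun j => by
      rw [hf3]; simp only [norm_mul, Complex.norm_real, Real.norm_eq_abs]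
      rw [abs_of_nonneg hx]
    have e4 : (absF f1 ζ + absF f2 ζ) + ∑ j, absF (f3 j) ζ =
        ((‖f1 ζ‖ + ‖f2 ζ‖ + ∑ j, ‖f3 j ζ‖ : ℝ) : ℂ) := by
      simp only [absF]; push_cast; rfl
    rw [e4, Complex.norm_real, Real.norm_eq_abs, norm_mul, Complex.norm_real, Real.norm_eq_abs,
      abs_of_nonneg (by positivity : 0 ≤ |tC ζ| ^ s), e1]
    simp only [e3]
    exact h.trans (le_abs_self _)
  have n2 := nrm_add_le l5 l4
  have n3 := nrm_add_le (absF_L2 l1) (absF_L2 l2)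
  rw [nrm_absF, nrm_absF] at n3
  have n5 : nrm f2 = nrm (X0 u) := nrm_fourier _
  rw [n5] at n3
  linarith

variable {σ : ℝ} {w : E n → ℝ}

open FourierTransform in
lemma final_nrm (hW : WH σ w) {a : Z n → ℝ} (ha : Continuous a) {B : ℝ} (hB : ∀ z, |a z| ≤ B)
    {a₀ : ℝ} (ha₀ : 0 < a₀) (hLB : ∀ z, a₀ ≤ a z) {K : Set (Z n)} (hK : IsCompact K) :
    ∃ D : ℝ, 0 < D ∧ ∀ u : SchwartzMap (Z n) ℂ, tsupport u ⊆ K →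
      L2 (fun ζ => (((1 + |tC ζ| ^ (2 * σ / (2 * σ + 1))
            + ‖xC ζ‖ ^ (2 * σ / (2 * σ + 1)) + ‖vC ζ‖ ^ (2 * σ)) : ℝ) : ℂ) * 𝓕 u ζ) ∧
      nrm (fun ζ => (((1 + |tC ζ| ^ (2 * σ / (2 * σ + 1))
            + ‖xC ζ‖ ^ (2 * σ / (2 * σ + 1)) + ‖vC ζ‖ ^ (2 * σ)) : ℝ) : ℂ) * 𝓕 u ζ)
        ≤ D * (nrm (Pop σ w a u) + nrm u) := by
  have hσ := hW.s0
  set s := 2 * σ / (2 * σ + 1) with hsdef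
  have hs : 0 ≤ s := by positivity
  have hs1 : s ≤ 1 := by rw [hsdef, div_le_one (by positivity)]; linarith
  have hB0 : 0 ≤ B := (abs_nonneg _).trans (hB 0)
  obtain ⟨D, hD0, hD⟩ := main_G hW ha hB ha₀ hLB hK
  obtain ⟨C, hC0, hC⟩ := tau_nrm hs hs1 hK
  refine ⟨(2 * C + 5 * B + 3) * D + 1, by positivity, fun u hu => ?_⟩
  have G := hD u hu
  have T := hC u hu
  set g : Z n → ℂ := fun ζ => (wG σ ζ : ℂ) * 𝓕 u ζ with hg
  have lg : L2 g := PG.wG.memL2 _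
  have xw : ∀ ζ : Z n, ‖xC ζ‖ ^ s ≤ wG σ ζ := fun ζ => (xpow_le hσ ζ).trans (wA_le_wG hσ ζ)
  have nx : nrm (fun ζ => ((1 + ‖xC ζ‖ ^ s : ℝ) : ℂ) * 𝓕 u ζ) ≤ 2 * nrm g := by
    refine nrm_mono lg (by norm_num) fun ζ => ?_
    rw [hg]
    simp only
    rw [nrm_ofR (wG_ge hσ ζ), norm_mul, Complex.norm_real, Real.norm_eq_abs,
      abs_of_nonneg (by positivity), ← mul_assoc]
    refine mul_le_mul_of_nonneg_right ?_ (norm_nonneg _)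
    linarith [xw ζ, wG_ge hσ ζ]
  have hP := Pop_L2 hW ha hB u
  have haL := aL_L2 hW ha hB u
  have nX : nrm (X0 u) ≤ nrm (Pop σ w a u) + 5 * B * nrm g := by
    have e : (X0 u : Z n → ℂ) = fun z => Pop σ w a u z - (a z : ℂ) * fracLap σ w u z := by
      ext z; rw [Pop_apply]; ring
    rw [e]
    refine (nrm_sub_le hP haL).trans ?_
    have h1 : nrm (fun z => (a z : ℂ) * fracLap σ w u z) ≤ B * nrm (fracLap σ w u) :=
      nrm_mono (fracLap_L2 hW u) hB0 fun z => by
        rw [norm_mul, Complex.norm_real]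
        exact mul_le_mul_of_nonneg_right (hB z) (norm_nonneg _)
    have h2 := mul_le_mul_of_nonneg_left (Lam_le hW u) hB0
    linarith
  have lt := tau_L2 hs u
  set f := fun ζ => ((|tC ζ| ^ s : ℝ) : ℂ) * 𝓕 u ζ with hf
  have lt3 : L2 (fun ζ => absF f ζ + 3 * absF g ζ) := (absF_L2 lt).add ((absF_L2 lg).const_mul 3)
  have pt : ∀ ζ, ‖(((1 + |tC ζ| ^ s + ‖xC ζ‖ ^ s + ‖vC ζ‖ ^ (2 * σ)) : ℝ) : ℂ) * 𝓕 u ζ‖ ≤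
      ‖absF f ζ + 3 * absF g ζ‖ := by
    intro ζ
    have e : absF f ζ + 3 * absF g ζ = ((‖f ζ‖ + 3 * ‖g ζ‖ : ℝ) : ℂ) := by
      simp only [absF]; push_cast; rfl
    have ht : 0 ≤ |tC ζ| ^ s := by positivity
    have hq : 0 ≤ 1 + |tC ζ| ^ s + ‖xC ζ‖ ^ s + ‖vC ζ‖ ^ (2 * σ) := by positivity
    have ef : ‖f ζ‖ = |tC ζ| ^ s * ‖𝓕 u ζ‖ := by
      simp only [hf, norm_mul, Complex.norm_real, Real.norm_eq_abs, abs_of_nonneg ht]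
    have eg : ‖g ζ‖ = wG σ ζ * ‖𝓕 u ζ‖ := nrm_ofR (wG_ge hσ ζ) _
    rw [e, Complex.norm_real, Real.norm_eq_abs]
    refine le_trans ?_ (le_abs_self _)
    rw [ef, eg, norm_mul, Complex.norm_real, Real.norm_eq_abs, abs_of_nonneg hq, ← mul_assoc, ← add_mul]
    refine mul_le_mul_of_nonneg_right ?_ (norm_nonneg _)
    linarith [xw ζ, wG_ge hσ ζ, vpow_le hσ ζ]
  have PGt : PG (fun ζ : Z n => 1 + |tC ζ| ^ s + ‖xC ζ‖ ^ s + ‖vC ζ‖ ^ (2 * σ)) := by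
    refine (((PG.const 1).add (PG.rpow0 (PG.of_le tC_cont.abs PG.norm fun ζ => ?_)
      (fun _ => abs_nonneg _) hs)).add (PG.xn.rpow0 (fun _ => norm_nonneg _) hs)).add
      (PG.vn.rpow0 (fun _ => norm_nonneg _) (by positivity))
    rw [abs_abs]; exact tC_le ζ
  refine ⟨PGt.memL2 _, (nrm_mono1 lt3 pt).trans ?_⟩
  have m1 := nrm_add_le (absF_L2 lt) ((absF_L2 lg).const_mul 3)
  have m2 : nrm (fun ζ => 3 * absF g ζ) ≤ 3 * nrm g := nrm_mono lg (by norm_num) fun ζ => by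
    rw [norm_mul, absF_norm]; simp
  rw [nrm_absF] at m1
  have m3 := mul_le_mul_of_nonneg_left nx hC0
  have m4 := mul_le_mul_of_nonneg_left G (by positivity : 0 ≤ 2 * C + 5 * B + 3)
  have m5 := nrm_nonneg (u : Z n → ℂ)
  calc _ ≤ nrm f + 3 * nrm g := m1.trans (by linarith)
    _ ≤ (2 * C + 5 * B + 3) * nrm g + nrm (Pop σ w a u) := by linarith
    _ ≤ (2 * C + 5 * B + 3) * (D * (nrm (Pop σ w a u) + nrm u)) + nrm (Pop σ w a u) := by linarith
    _ ≤ _ := by linarith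

lemma nrm_conv {f g h : Z n → ℂ} (hf : L2 f) (hg : L2 g) (hh : L2 h) {D : ℝ} (hD : 0 < D)
    (hN : nrm f ≤ D * (nrm g + nrm h)) :
    eLpNorm f 2 volume ≤ ENNReal.ofReal D * (eLpNorm g 2 volume + eLpNorm h 2 volume) := by
  refine (ENNReal.toReal_le_toReal hf.2.ne
    (ENNReal.mul_ne_top ENNReal.ofReal_ne_top (ENNReal.add_ne_top.2 ⟨hg.2.ne, hh.2.ne⟩))).1 ?_
  rw [ENNReal.toReal_mul, ENNReal.toReal_ofReal hD.le, ENNReal.toReal_add hg.2.ne hh.2.ne]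
  exact hN

end PartI

/-- Proposition 3.1: optimal hypoelliptic estimate in `L²`
for smooth compactly supported functions with support in a fixed compact set `K`. -/
theorem statement5
    (n : ℕ) (hn : 1 ≤ n) (σ : ℝ) (hσ0 : 0 < σ) (hσ1 : σ < 1)
    (w : E n → ℝ) (hw : ContDiff ℝ (⊤ : ℕ∞) w)
    (hw01 : ∀ η, 0 ≤ w η ∧ w η ≤ 1)
    (hwout : ∀ η : E n, 2 ≤ ‖η‖ → w η = 1)
    (hwin : ∀ η : E n, ‖η‖ ≤ 1 → w η = 0)
    (a : Z n → ℝ) (ha : ContDiff ℝ (⊤ : ℕ∞) a)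
    (haB : ∀ k : ℕ, ∃ C : ℝ, ∀ z, ‖iteratedFDeriv ℝ k a z‖ ≤ C)
    (a₀ : ℝ) (ha₀ : 0 < a₀) (haLB : ∀ z, a₀ ≤ a z)
    (K : Set (Z n)) (hK : IsCompact K) :
    ∃ C : ℝ, 0 < C ∧ ∀ u : Z n → ℂ,
      ContDiff ℝ (⊤ : ℕ∞) u → HasCompactSupport u → tsupport u ⊆ K →
      eLpNorm (fun ζ => (((1 + |tC ζ| ^ (2 * σ / (2 * σ + 1))
            + ‖xC ζ‖ ^ (2 * σ / (2 * σ + 1)) + ‖vC ζ‖ ^ (2 * σ)) : ℝ) : ℂ)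
          * FourierTransform.fourier u ζ) 2 volume
        ≤ ENNReal.ofReal C *
          (eLpNorm (Pop σ w a u) 2 volume + eLpNorm u 2 volume) := by
  have hW : WH σ w := ⟨hσ0, hσ1, hw.continuous, hw01, hwout⟩
  obtain ⟨B, hB⟩ := haB 0
  have hB' : ∀ z, |a z| ≤ B := fun z => by
    have := hB z
    rwa [norm_iteratedFDeriv_zero] at this
  obtain ⟨D, hD0, hD⟩ := final_nrm hW ha.continuous hB' ha₀ haLB hK
  refine ⟨D, hD0, fun u hu hc hs => ?_⟩
  obtain ⟨U, rfl⟩ : ∃ U : SchwartzMap (Z n) ℂ, u = U := ⟨hc.toSchwartzMap hu, rfl⟩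
  obtain ⟨hL, hN⟩ := hD U hs
  rw [SchwartzMap.fourier_coe] at hL hN
  exact nrm_conv hL (Pop_L2 hW ha.continuous hB' U) (U.memLp 2) hD0 hN
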